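/- arXiv:2011.06915 — 9 statements merged into one kernel-verified Lean document; each statement's English description precedes it below -/
import Mathlib

section
/- Let n ≥ 2 be a natural number and let s₀ > n − 1. Then there exists a solution w : (0,∞) → ℝ of (★), defined on all of (0,∞), such that w(s) > 1 for every s > 0, w(s₀) = s₀/(n−1), s₀ is the unique critical point of w (w'(s₀) = 0 and w'(s) ≠ 0 for s ≠ s₀), w(s) → 1 as s → 0⁺, and w(s) → 1 as s → +∞. -/
open Set Filter

lemma aux_unique (v : ℝ → ℝ → ℝ)
    (hK : ∀ a : ℝ, 0 < a → ∃ K : NNReal, ∀ t, a ≤ t → LipschitzWith K (v t))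
    {a b : ℝ} (ha : 0 < a) {t₀ : ℝ} (ht : t₀ ∈ Ioo a b) {f g : ℝ → ℝ}
    (hf : ∀ t ∈ Ioo a b, HasDerivAt f (v t (f t)) t)
    (hg : ∀ t ∈ Ioo a b, HasDerivAt g (v t (g t)) t) (h : f t₀ = g t₀) :
    EqOn f g (Ioo a b) := by
  obtain ⟨K, hK⟩ := hK a ha
  exact ODE_solution_unique_of_mem_Ioo (s := fun _ => univ) (K := K) (v := v)
    (fun t ht => (hK t ht.1.le).lipschitzOnWith) ht
    (fun t ht => ⟨hf t ht, mem_univ _⟩) (fun t ht => ⟨hg t ht, mem_univ _⟩) h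

lemma aux_exists (v : ℝ → ℝ → ℝ)
    (hK : ∀ a : ℝ, 0 < a → ∃ K : NNReal, ∀ t, a ≤ t → LipschitzWith K (v t))
    (hL : ∀ a : ℝ, 0 < a → ∃ L : NNReal, ∀ t, a ≤ t → ∀ x, ‖v t x‖ ≤ L)
    (hc : ∀ x, ContinuousOn (fun t => v t x) (Ioi 0))
    {a b : ℝ} (ha : 0 < a) {t₀ : ℝ} (ht : t₀ ∈ Ioo a b) (x₀ : ℝ) :
    ∃ f : ℝ → ℝ, f t₀ = x₀ ∧ ∀ t ∈ Ioo a b, HasDerivAt f (v t (f t)) t := by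
  obtain ⟨K, hK⟩ := hK a ha
  obtain ⟨L, hL⟩ := hL a ha
  have hm : 0 ≤ max (b - t₀) (t₀ - a) := le_max_of_le_left (by linarith [ht.2])
  have hP : IsPicardLindelof v (tmin := a) (tmax := b) ⟨t₀, ht.1.le, ht.2.le⟩ x₀
      (L * NNReal.mk (max (b - t₀) (t₀ - a)) hm) 0 L K := by
    refine ⟨fun t ht => (hK t ht.1).lipschitzOnWith, fun x _ => (hc x).mono ?_,
      fun t ht x _ => hL t ht.1 x, ?_⟩
    · intro t ht
      exact lt_of_lt_of_le ha ht.1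
    · simp
  obtain ⟨f, h1, h2⟩ := hP.exists_eq_forall_mem_Icc_hasDerivWithinAt₀
  exact ⟨f, h1, fun t ht => (h2 t ⟨ht.1.le, ht.2.le⟩).hasDerivAt (Icc_mem_nhds ht.1 ht.2)⟩

lemma aux_global (v : ℝ → ℝ → ℝ)
    (hK : ∀ a : ℝ, 0 < a → ∃ K : NNReal, ∀ t, a ≤ t → LipschitzWith K (v t))
    (hL : ∀ a : ℝ, 0 < a → ∃ L : NNReal, ∀ t, a ≤ t → ∀ x, ‖v t x‖ ≤ L)
    (hc : ∀ x, ContinuousOn (fun t => v t x) (Ioi 0))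
    {t₀ : ℝ} (ht : 0 < t₀) (x₀ : ℝ) :
    ∃ f : ℝ → ℝ, f t₀ = x₀ ∧ ∀ t, 0 < t → HasDerivAt f (v t (f t)) t := by
  have hpos : ∀ k : ℕ, 0 < t₀ / ((k : ℝ) + 2) := fun k => by positivity
  have hmem : ∀ k : ℕ, t₀ ∈ Ioo (t₀ / ((k : ℝ) + 2)) (t₀ * ((k : ℝ) + 2)) := fun k => by
    have hk : (0 : ℝ) ≤ k := Nat.cast_nonneg k
    constructor
    · rw [div_lt_iff₀ (by positivity)]; nlinarith
    · nlinarith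
  choose W hW0 hW using fun k : ℕ => aux_exists v hK hL hc (hpos k) (hmem k) x₀
  have hsub : ∀ j k : ℕ, j ≤ k → Ioo (t₀ / ((j : ℝ) + 2)) (t₀ * ((j : ℝ) + 2)) ⊆
      Ioo (t₀ / ((k : ℝ) + 2)) (t₀ * ((k : ℝ) + 2)) := by
    intro j k hjk
    have : (j : ℝ) ≤ k := Nat.cast_le.2 hjk
    apply Ioo_subset_Ioo
    · gcongr
    · gcongr
  have hag : ∀ j k : ℕ, j ≤ k → EqOn (W j) (W k)
      (Ioo (t₀ / ((j : ℝ) + 2)) (t₀ * ((j : ℝ) + 2))) := fun j k hjk =>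
    aux_unique v hK (hpos j) (hmem j) (hW j) (fun t ht => hW k t (hsub j k hjk ht))
      (by rw [hW0, hW0])
  have hex : ∀ s : ℝ, ∃ k : ℕ, 0 < s → s ∈ Ioo (t₀ / ((k : ℝ) + 2)) (t₀ * ((k : ℝ) + 2)) := by
    intro s
    obtain ⟨k, hk⟩ := exists_nat_gt (max (t₀ / s) (s / t₀))
    refine ⟨k, fun hs => ?_⟩
    have h1 := (le_max_left _ _).trans_lt hk
    have h2 := (le_max_right _ _).trans_lt hk
    rw [div_lt_iff₀ hs] at h1
    rw [div_lt_iff₀ ht] at h2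
    constructor
    · rw [div_lt_iff₀ (by positivity)]; nlinarith
    · nlinarith
  choose κ hκ using hex
  have hkey : ∀ k : ℕ, ∀ t ∈ Ioo (t₀ / ((k : ℝ) + 2)) (t₀ * ((k : ℝ) + 2)),
      W (κ t) t = W k t := by
    intro k t htk
    have h0 : 0 < t := (hpos k).trans htk.1
    rcases le_total (κ t) k with h | h
    · exact hag _ _ h (hκ t h0)
    · exact (hag _ _ h htk).symm
  refine ⟨fun t => W (κ t) t, hW0 _, fun t h0 => ?_⟩
  refine (hW (κ t) t (hκ t h0)).congr_of_eventuallyEq ?_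
  filter_upwards [Ioo_mem_nhds (hκ t h0).1 (hκ t h0).2] with y hy
  exact hkey _ y hy

lemma aux_cross {f f' : ℝ → ℝ} {a b c : ℝ} (hab : a < b) (hbc : b < c)
    (hf : ∀ x ∈ Icc a c, HasDerivAt f (f' x) x) (ha : f a ≤ 0)
    (hz : ∀ x ∈ Icc a c, f x = 0 → f' x < 0) : f b < 0 := by
  have hle : ∀ ⦃x⦄, x ∈ Icc a c → f x ≤ (fun _ => (0 : ℝ)) x :=
    image_le_of_deriv_right_lt_deriv_boundary (f' := f') (B' := fun _ => 0)
      (fun x hx => (hf x hx).continuousAt.continuousWithinAt)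
      (fun x hx => (hf x ⟨hx.1, hx.2.le⟩).hasDerivWithinAt) ha
      (fun x => hasDerivAt_const _ _) (fun x hx h => hz x ⟨hx.1, hx.2.le⟩ h)
  have hb : b ∈ Icc a c := ⟨hab.le, hbc.le⟩
  refine lt_of_le_of_ne (hle hb) fun h0 => ?_
  have hmax : IsLocalMax f b := by
    filter_upwards [Icc_mem_nhds hab hbc] with x hx
    rw [h0]; exact hle hx
  have := hmax.hasDerivAt_eq_zero (hf b hb)
  have := hz b hb h0
  linarith

lemma aux_mono {f f' : ℝ → ℝ} {a b : ℝ} (hab : a ≤ b)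
    (hf : ∀ x ∈ Icc a b, HasDerivAt f (f' x) x) (h : ∀ x ∈ Icc a b, 0 ≤ f' x) :
    f a ≤ f b := by
  refine monotoneOn_of_deriv_nonneg (convex_Icc a b)
    (fun x hx => (hf x hx).continuousAt.continuousWithinAt) (fun x hx => ?_) (fun x hx => ?_)
    (left_mem_Icc.2 hab) (right_mem_Icc.2 hab) hab
  · exact (hf x (interior_subset hx)).differentiableAt.differentiableWithinAt
  · rw [(hf x (interior_subset hx)).deriv]; exact h x (interior_subset hx)

/-- truncation -/
noncomputable def auxc (M x : ℝ) : ℝ := max 1 (min x M)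

noncomputable def auxv (m M s x : ℝ) : ℝ := (1 - auxc M x ^ 2) * (1 - m * auxc M x / s)

lemma auxc_lip (M x y : ℝ) : |auxc M x - auxc M y| ≤ |x - y| := by
  unfold auxc
  refine (abs_max_sub_max_le_max _ _ _ _).trans ?_
  refine max_le (by simp) ((abs_min_sub_min_le_max _ _ _ _).trans ?_)
  exact max_le le_rfl (by simp)

theorem exists_solution_with_unique_critical_point (n : ℕ) (hn : 2 ≤ n)
    (s₀ : ℝ) (hs₀ : (n : ℝ) - 1 < s₀) :
    ∃ w : ℝ → ℝ,
      (∀ s : ℝ, 0 < s →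
        HasDerivAt w ((1 - w s ^ 2) * (1 - (n - 1 : ℝ) * w s / s)) s) ∧
      (∀ s : ℝ, 0 < s → 1 < w s) ∧
      w s₀ = s₀ / (n - 1 : ℝ) ∧
      deriv w s₀ = 0 ∧
      (∀ s : ℝ, 0 < s → s ≠ s₀ → deriv w s ≠ 0) ∧
      Tendsto w (nhdsWithin 0 (Set.Ioi 0)) (nhds 1) ∧
      Tendsto w atTop (nhds 1) := by
  have hm1 : (1 : ℝ) ≤ (n : ℝ) - 1 := by
    have : (2 : ℝ) ≤ n := by exact_mod_cast hn
    linarith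
  generalize (n : ℝ) - 1 = m at *
  have hm : 0 < m := by linarith
  have hs0 : 0 < s₀ := by linarith
  obtain ⟨M, hM⟩ : ∃ M, M = s₀ / m := ⟨_, rfl⟩
  have hmM : m * M = s₀ := by rw [hM]; field_simp
  have hM1 : 1 < M := by rw [hM, lt_div_iff₀ hm]; linarith
  have hc1 : ∀ x, 1 ≤ auxc M x := fun x => le_max_left _ _
  have hcM : ∀ x, auxc M x ≤ M := fun x => max_le hM1.le (min_le_right _ _)
  have hk : ∀ a : ℝ, 0 < a → ∀ t, a ≤ t → 0 ≤ m / t ∧ m / t ≤ m / a := fun a ha t hat =>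
    ⟨div_nonneg hm.le (ha.le.trans hat), by gcongr⟩
  have hK : ∀ a : ℝ, 0 < a → ∃ K : NNReal, ∀ t, a ≤ t → LipschitzWith K (auxv m M t) := by
    intro a ha
    have hKn : 0 ≤ 2 * M + m / a * (3 * M ^ 2 + 1) := by positivity
    refine ⟨NNReal.mk _ hKn, fun t hat => LipschitzWith.of_dist_le_mul fun x y => ?_⟩
    rw [Real.dist_eq, Real.dist_eq, NNReal.coe_mk]
    refine le_trans ?_ (mul_le_mul_of_nonneg_left (auxc_lip M x y) hKn)
    unfold auxv
    obtain ⟨h1, h2⟩ := hk a ha t hat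
    have p1 := hc1 x
    have p2 := hcM x
    have q1 := hc1 y
    have q2 := hcM y
    generalize auxc M x = p at *
    generalize auxc M y = q at *
    have : (1 - p ^ 2) * (1 - m * p / t) - (1 - q ^ 2) * (1 - m * q / t) =
        (-(p + q) + m / t * (p ^ 2 + p * q + q ^ 2 - 1)) * (p - q) := by ring
    rw [this, abs_mul]
    refine mul_le_mul_of_nonneg_right ?_ (abs_nonneg _)
    have e1 : 0 ≤ p ^ 2 + p * q + q ^ 2 - 1 := by nlinarith
    have e2 : p ^ 2 + p * q + q ^ 2 - 1 ≤ 3 * M ^ 2 + 1 := by nlinarith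
    have e3 := mul_nonneg h1 e1
    have e4 : m / t * (p ^ 2 + p * q + q ^ 2 - 1) ≤ m / a * (3 * M ^ 2 + 1) :=
      mul_le_mul h2 e2 e1 (h1.trans h2)
    rw [abs_le]
    constructor <;> linarith
  have hL : ∀ a : ℝ, 0 < a → ∃ L : NNReal, ∀ t, a ≤ t → ∀ x, ‖auxv m M t x‖ ≤ L := by
    intro a ha
    have hKn : 0 ≤ M ^ 2 * (1 + m / a * M) := by positivity
    refine ⟨NNReal.mk _ hKn, fun t hat x => ?_⟩
    rw [Real.norm_eq_abs, NNReal.coe_mk]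
    unfold auxv
    obtain ⟨h1, h2⟩ := hk a ha t hat
    have p1 := hc1 x
    have p2 := hcM x
    generalize auxc M x = p at *
    rw [abs_mul]
    have e1 : 0 ≤ m / t * p := mul_nonneg h1 (by linarith)
    have e2 : m / t * p ≤ m / a * M := mul_le_mul h2 p2 (by linarith) (h1.trans h2)
    refine mul_le_mul ?_ ?_ (abs_nonneg _) (by positivity)
    · rw [abs_le]; constructor <;> nlinarith
    · rw [mul_div_right_comm, abs_le]; constructor <;> linarith
  have hc : ∀ x, ContinuousOn (fun t => auxv m M t x) (Ioi 0) := by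
    intro x
    unfold auxv
    refine continuousOn_const.mul (continuousOn_const.sub (continuousOn_const.div continuousOn_id ?_))
    intro t ht
    exact (ne_of_gt ht)
  obtain ⟨w, hw0, hw⟩ := aux_global (auxv m M) hK hL hc hs0 M
  have hcont : ContinuousOn w (Ioi 0) := fun x hx => (hw x hx).continuousAt.continuousWithinAt
  -- w > 1
  have hw1 : ∀ s, 0 < s → 1 < w s := by
    intro s hs
    by_contra hle
    push Not at hle
    have : (1 : ℝ) ∈ w '' (Ioi 0) := by
      refine isPreconnected_Ioi.intermediate_value (mem_Ioi.2 hs) (mem_Ioi.2 hs0) hcont ⟨hle, ?_⟩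
      rw [hw0]; exact hM1.le
    obtain ⟨t, ht, ht1⟩ := this
    have ht : 0 < t := ht
    have := aux_unique (auxv m M) hK (a := min t s₀ / 2) (b := max t s₀ + 1)
      (by have := lt_min ht hs0; positivity) (t₀ := t)
      ⟨by have := lt_min ht hs0; linarith [min_le_left t s₀], by linarith [le_max_left t s₀]⟩
      (f := w) (g := fun _ => 1)
      (fun x hx => hw x (lt_trans (by have := lt_min ht hs0; positivity) hx.1))
      (fun x hx => by
        have : auxv m M x 1 = 0 := by simp [auxv, auxc, hM1.le]
        rw [this]; exact hasDerivAt_const _ _) ht1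
    have := this (x := s₀)
      ⟨by have := lt_min ht hs0; linarith [min_le_right t s₀], by linarith [le_max_right t s₀]⟩
    rw [hw0] at this
    linarith
  have hcw : ∀ s, 0 < s → auxc M (w s) = min (w s) M := fun s hs =>
    max_eq_right (le_min (hw1 s hs).le hM1.le)
  -- sign of v
  have hneg : ∀ s, 0 < s → m * min (w s) M < s → auxv m M s (w s) < 0 := by
    intro s hs h
    have h1 : 1 < min (w s) M := lt_min (hw1 s hs) hM1
    unfold auxv
    rw [hcw s hs]
    apply mul_neg_of_neg_of_pos
    · nlinarith
    · rw [sub_pos, div_lt_one hs]; exact h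
  have hpos : ∀ s, 0 < s → s < m * min (w s) M → 0 < auxv m M s (w s) := by
    intro s hs h
    have h1 : 1 < min (w s) M := lt_min (hw1 s hs) hM1
    unfold auxv
    rw [hcw s hs]
    apply mul_pos_of_neg_of_neg
    · nlinarith
    · rw [sub_neg, one_lt_div hs]; exact h
  have hh : ∀ s, 0 < s → HasDerivAt (fun s => m * w s - s) (m * auxv m M s (w s) - 1) s :=
    fun s hs => ((hw s hs).const_mul m).sub (hasDerivAt_id s)
  have hz : ∀ s, 0 < s → m * w s - s = 0 → m * auxv m M s (w s) - 1 < 0 := by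
    intro s hs h
    have : auxv m M s (w s) ≤ 0 := by
      rcases le_total (w s) M with h1 | h1
      · unfold auxv
        rw [hcw s hs, min_eq_left h1]
        have : m * w s / s = 1 := by rw [div_eq_one_iff_eq hs.ne']; linarith
        rw [this]; simp
      · rcases h1.eq_or_lt with h2 | h2
        · unfold auxv
          rw [hcw s hs, ← h2, min_self]
          have : m * M / s = 1 := by rw [div_eq_one_iff_eq hs.ne', h2]; linarith
          rw [this]; simp
        · refine (hneg s hs ?_).le
          rw [min_eq_right h1]; nlinarith
    nlinarith
  have hright : ∀ s, s₀ < s → m * w s < s := by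
    intro s hs
    have := aux_cross (f := fun s => m * w s - s) (a := s₀) (b := s) (c := s + 1) hs (by linarith)
      (fun x hx => hh x (by linarith [hx.1])) (by simp [hw0, hmM])
      (fun x hx h => hz x (by linarith [hx.1]) h)
    linarith
  have hleft : ∀ s, 0 < s → s < s₀ → s < m * w s := by
    intro s hs hs'
    have := aux_cross (f := fun s => -(m * w (-s) - (-s))) (a := -s₀) (b := -s) (c := -(s / 2))
      (f' := fun s => m * auxv m M (-s) (w (-s)) - 1)
      (by linarith) (by linarith)
      (fun x hx => by
        have := ((hh (-x) (by linarith [hx.2])).comp x (hasDerivAt_neg x)).neg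
        refine this.congr_deriv ?_
        ring) (by simp [hw0, hmM])
      (fun x hx h => hz (-x) (by linarith [hx.2]) (by linarith))
    simp only [neg_neg] at this
    linarith
  have hvneg : ∀ s, s₀ < s → auxv m M s (w s) < 0 := fun s hs =>
    hneg s (by linarith) (lt_of_le_of_lt
      (mul_le_mul_of_nonneg_left (min_le_left _ _) hm.le) (hright s hs))
  have hvpos : ∀ s, 0 < s → s < s₀ → 0 < auxv m M s (w s) := fun s h0 hs =>
    hpos s h0 (by
      rw [mul_min_of_nonneg _ _ hm.le]
      exact lt_min (hleft s h0 hs) (by linarith))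
  have hv0 : auxv m M s₀ (w s₀) = 0 := by
    unfold auxv
    rw [hcw s₀ hs0, hw0, min_self, hmM, div_self hs0.ne']; simp
  have hanti : ∀ s t, s₀ ≤ s → s ≤ t → w t ≤ w s := by
    intro s t hs hst
    have := aux_mono (f := fun x => - w x) hst (fun x hx => (hw x (by linarith [hx.1])).neg)
      (fun x hx => by
        rcases (hs.trans hx.1).eq_or_lt with h | h
        · rw [← h, hv0]; simp
        · linarith [hvneg x h])
    linarith
  have hmon : ∀ s t, 0 < s → s ≤ t → t ≤ s₀ → w s ≤ w t := by
    intro s t hs hst ht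
    exact aux_mono (f := w) hst (fun x hx => (hw x (by linarith [hx.1])))
      (fun x hx => by
        rcases (hx.2.trans ht).eq_or_lt with h | h
        · rw [h, hv0]
        · exact (hvpos x (by linarith [hx.1]) h).le)
  have hwM : ∀ s, 0 < s → w s ≤ M := by
    intro s hs
    rw [← hw0]
    rcases le_total s s₀ with h | h
    · exact hmon s s₀ hs h le_rfl
    · exact hanti s₀ s le_rfl h
  have hveq : ∀ s, 0 < s → auxv m M s (w s) = (1 - w s ^ 2) * (1 - m * w s / s) := by
    intro s hs
    unfold auxv
    rw [hcw s hs, min_eq_left (hwM s hs)]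
  refine ⟨w, fun s hs => hveq s hs ▸ hw s hs, hw1, by rw [hw0, hM], by rw [(hw s₀ hs0).deriv, hv0],
    ?_, ?_, ?_⟩
  · intro s hs hne
    rw [(hw s hs).deriv]
    rcases lt_or_gt_of_ne hne with h | h
    · exact (hvpos s hs h).ne'
    · exact (hvneg s h).ne
  · rw [Metric.tendsto_nhdsWithin_nhds]
    intro ε hε
    obtain ⟨s₁, h1, h2, h3⟩ : ∃ s₁, 0 < s₁ ∧ s₁ ≤ s₀ ∧ w s₁ < 1 + ε := by
      by_contra hcon
      push Not at hcon
      have key : ∀ s, 0 < s → s ≤ m / 2 →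
          w s - ε * Real.log s ≤ w (m / 2) - ε * Real.log (m / 2) := by
        intro s hs hs2
        refine aux_mono (f := fun x => w x - ε * Real.log x) hs2
          (fun x hx => (hw x (by linarith [hx.1])).sub
            ((Real.hasDerivAt_log (by linarith [hx.1] : (0:ℝ) < x).ne').const_mul ε))
          (fun x hx => ?_)
        have hx0 : 0 < x := by linarith [hx.1]
        have hwx := hcon x hx0 (by linarith [hx.2])
        rw [hveq x hx0]
        have e : (1 - w x ^ 2) * (1 - m * w x / x) - ε * x⁻¹ =
            ((w x ^ 2 - 1) * (m * w x - x) - ε) * x⁻¹ := by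
          field_simp; ring
        rw [e]
        refine mul_nonneg ?_ (inv_nonneg.2 hx0.le)
        have a1 : 2 * ε ≤ w x ^ 2 - 1 := by nlinarith
        have a2 : 1 / 2 ≤ m * w x - x := by nlinarith [hx.2]
        nlinarith
      have hlog : ∀ᶠ s in nhdsWithin (0:ℝ) (Ioi 0),
          Real.log s < Real.log (m / 2) - M / ε :=
        Real.tendsto_log_nhdsGT_zero.eventually (eventually_lt_atBot _)
      have h2 : ∀ᶠ s in nhdsWithin (0:ℝ) (Ioi 0), s < m / 2 :=
        mem_nhdsWithin_of_mem_nhds (Iio_mem_nhds (by positivity))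
      obtain ⟨s, ⟨hsl, hs2⟩, hs⟩ := ((hlog.and h2).and self_mem_nhdsWithin).exists
      have hs : 0 < s := hs
      have k1 := key s hs hs2.le
      have k2 := hw1 s hs
      have k3 := hwM (m / 2) (by positivity)
      have k4 : ε * Real.log s < ε * (Real.log (m / 2) - M / ε) := mul_lt_mul_of_pos_left hsl hε
      have k5 : ε * (M / ε) = M := by field_simp
      rw [mul_sub, k5] at k4
      linarith
    refine ⟨s₁, h1, fun x hx hd => ?_⟩
    have hx : 0 < x := hx
    rw [Real.dist_eq, sub_zero, abs_of_pos hx] at hd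
    have k1 := hw1 x hx
    have k2 := hmon x s₁ hx hd.le h2
    rw [Real.dist_eq, abs_of_pos (by linarith)]
    linarith
  · rw [Metric.tendsto_atTop]
    intro ε hε
    obtain ⟨s₁, h2, h3⟩ : ∃ s₁, s₀ ≤ s₁ ∧ w s₁ < 1 + ε := by
      by_contra hcon
      push Not at hcon
      have key : ∀ s, 2 * s₀ ≤ s → w s + ε * s ≤ w (2 * s₀) + ε * (2 * s₀) := by
        intro s hs
        have := aux_mono (f := fun x => -(w x + ε * x)) hs
          (fun x hx => ((hw x (by linarith [hx.1])).add ((hasDerivAt_id x).const_mul ε)).neg)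
          (fun x hx => by
            have hx0 : 0 < x := by linarith [hx.1]
            have hwx := hcon x (by linarith [hx.1])
            rw [hveq x hx0]
            have a1 : 2 * ε ≤ w x ^ 2 - 1 := by nlinarith
            have a2 : m * w x / x ≤ 1 / 2 := by
              rw [div_le_iff₀ hx0]
              have := mul_le_mul_of_nonneg_left (hwM x hx0) hm.le
              linarith [hx.1]
            nlinarith)
        linarith
      have hd : 0 < M / ε := by positivity
      have k1 := key (2 * s₀ + M / ε) (by linarith)
      have k2 := hw1 (2 * s₀ + M / ε) (by linarith)
      have k3 := hwM (2 * s₀) (by positivity)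
      have k5 : ε * (M / ε) = M := by field_simp
      rw [mul_add, k5] at k1
      linarith
    refine ⟨s₁, fun x hx => ?_⟩
    have k1 := hw1 x (by linarith)
    have k2 := hanti s₁ x h2 hx
    rw [Real.dist_eq, abs_of_pos (by linarith)]
    linarith
end

section
/- Let n ≥ 2 be a natural number, let 𝐰 : (0,∞) → ℝ be the unique solution of (★) on (0,∞) with 𝐰 > 1 everywhere and no critical points, and let w be a solution of (★) with 1 < w(s₀) < 𝐰(s₀) at some s₀ > 0. Then the maximal solution extending w is defined on all of (0,∞), satisfies 1 < w(s) < 𝐰(s) for every s > 0, has exactly one critical point s₁ > 0 (at which w(s₁) = s₁/(n−1)), and satisfies w(s) → 1 as s → +∞ and w(s) → 1 as s → 0⁺. -/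
open Set Filter

noncomputable def starF (m s x : ℝ) : ℝ := (1 - x ^ 2) * (1 - m * x / s)

noncomputable def clampF (C x : ℝ) : ℝ := max (-C) (min C x)

lemma clampF_abs (C x : ℝ) (hC : 0 ≤ C) : |clampF C x| ≤ C := by
  unfold clampF
  rw [abs_le]
  exact ⟨le_max_left _ _, max_le (by linarith) (min_le_left _ _)⟩

lemma clampF_id (C x : ℝ) (h : |x| ≤ C) : clampF C x = x := by
  unfold clampF
  rw [abs_le] at h
  rw [min_eq_right h.2, max_eq_right h.1]

lemma clampF_lip (C x y : ℝ) : |clampF C x - clampF C y| ≤ |x - y| := by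
  have h : LipschitzWith 1 (clampF C) := (LipschitzWith.id.const_min C).const_max (-C)
  simpa [Real.dist_eq] using h.dist_le_mul x y

lemma starF_lip (m α C s x y : ℝ) (hm : 0 ≤ m) (hα : 0 < α) (hs : α ≤ s)
    (hx : |x| ≤ C) (hy : |y| ≤ C) :
    |starF m s x - starF m s y| ≤ (2 * C + m / α + 3 * C ^ 2 * (m / α)) * |x - y| := by
  have hq : m / s ≤ m / α := div_le_div_of_nonneg_left hm hα hs
  have hq0 : 0 ≤ m / s := div_nonneg hm (by linarith)
  have hC : 0 ≤ C := (abs_nonneg x).trans hx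
  have e : starF m s x - starF m s y
      = (-(x + y) - m / s + (m / s) * (x ^ 2 + x * y + y ^ 2)) * (x - y) := by
    unfold starF; ring
  rw [e, abs_mul]
  refine mul_le_mul_of_nonneg_right ?_ (abs_nonneg _)
  have h1 : |x ^ 2 + x * y + y ^ 2| ≤ 3 * C ^ 2 := by
    rw [abs_le] at *
    constructor <;> nlinarith
  have h2 : |(m / s) * (x ^ 2 + x * y + y ^ 2)| ≤ (m / α) * (3 * C ^ 2) := by
    rw [abs_mul, abs_of_nonneg hq0]
    exact mul_le_mul hq h1 (abs_nonneg _) (by linarith)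
  rw [abs_le] at *
  constructor <;> linarith

lemma starF_bound (m α C s x : ℝ) (hm : 0 ≤ m) (hα : 0 < α) (hs : α ≤ s) (hx : |x| ≤ C) :
    |starF m s x| ≤ (1 + C ^ 2) * (1 + (m / α) * C) := by
  have hq : m / s ≤ m / α := div_le_div_of_nonneg_left hm hα hs
  have hq0 : 0 ≤ m / s := div_nonneg hm (by linarith)
  have hC : 0 ≤ C := (abs_nonneg x).trans hx
  have h2 : |(m / s) * x| ≤ (m / α) * C := by
    rw [abs_mul, abs_of_nonneg hq0]
    exact mul_le_mul hq hx (abs_nonneg _) (by linarith)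
  have e : m * x / s = (m / s) * x := by ring
  unfold starF
  rw [abs_mul, e]
  have h1 : |1 - x ^ 2| ≤ 1 + C ^ 2 := by
    rw [abs_le] at *
    constructor <;> nlinarith
  refine mul_le_mul h1 ?_ (abs_nonneg _) (by positivity)
  rw [abs_le] at *
  constructor <;> linarith

lemma clamped_lip (m α C : ℝ) (hm : 0 ≤ m) (hα : 0 < α) (hC : 0 ≤ C) :
    ∃ K : NNReal, ∀ s, α ≤ s → LipschitzWith K (fun x => starF m s (clampF C x)) := by
  have hk : 0 ≤ 2 * C + m / α + 3 * C ^ 2 * (m / α) := by positivity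
  refine ⟨⟨_, hk⟩, fun s hs => LipschitzWith.of_dist_le_mul fun x y => ?_⟩
  rw [Real.dist_eq, Real.dist_eq]
  exact (starF_lip m α C s _ _ hm hα hs (clampF_abs C x hC) (clampF_abs C y hC)).trans
    (mul_le_mul_of_nonneg_left (clampF_lip C x y) hk)

lemma clamped_unique (m α β C : ℝ) (hm : 0 ≤ m) (hα : 0 < α) (hC : 0 ≤ C) (f g : ℝ → ℝ)
    (t₀ : ℝ) (ht : t₀ ∈ Ioo α β)
    (hf : ∀ t ∈ Ioo α β, HasDerivAt f (starF m t (clampF C (f t))) t)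
    (hg : ∀ t ∈ Ioo α β, HasDerivAt g (starF m t (clampF C (g t))) t)
    (h : f t₀ = g t₀) : EqOn f g (Ioo α β) := by
  obtain ⟨K, hK⟩ := clamped_lip m α C hm hα hC
  exact ODE_solution_unique_of_mem_Ioo (v := fun t x => starF m t (clampF C x))
    (s := fun _ => univ) (K := K)
    (fun t ht => (hK t ht.1.le).lipschitzOnWith) ht
    (fun t ht => ⟨hf t ht, trivial⟩) (fun t ht => ⟨hg t ht, trivial⟩) h

lemma star_unique (m a b : ℝ) (hm : 0 ≤ m) (ha : 0 ≤ a) (f g : ℝ → ℝ)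
    (t₀ : ℝ) (ht : t₀ ∈ Ioo a b)
    (hf : ∀ t ∈ Ioo a b, HasDerivAt f (starF m t (f t)) t)
    (hg : ∀ t ∈ Ioo a b, HasDerivAt g (starF m t (g t)) t)
    (h : f t₀ = g t₀) : EqOn f g (Ioo a b) := by
  intro t ht'
  obtain ⟨α, h1, h2⟩ := exists_between (lt_min ht.1 ht'.1)
  obtain ⟨β, h3, h4⟩ := exists_between (max_lt ht.2 ht'.2)
  rw [lt_min_iff] at h2
  rw [max_lt_iff] at h3
  have hsub : Icc α β ⊆ Ioo a b := fun x hx => ⟨h1.trans_le hx.1, hx.2.trans_lt h4⟩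
  obtain ⟨A, hA⟩ := isCompact_Icc.exists_bound_of_continuousOn
    (HasDerivAt.continuousOn fun x hx => hf x (hsub hx))
  obtain ⟨B, hB⟩ := isCompact_Icc.exists_bound_of_continuousOn
    (HasDerivAt.continuousOn fun x hx => hg x (hsub hx))
  refine clamped_unique m α β (max 0 (max A B)) hm (by linarith) (le_max_left _ _) f g t₀
    ⟨h2.1, h3.1⟩ (fun x hx => ?_) (fun x hx => ?_) h ⟨h2.2, h3.2⟩
  · rw [clampF_id]
    · exact hf x (hsub (Ioo_subset_Icc_self hx))
    · exact (hA x (Ioo_subset_Icc_self hx)).trans ((le_max_left _ _).trans (le_max_right _ _))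
  · rw [clampF_id]
    · exact hg x (hsub (Ioo_subset_Icc_self hx))
    · exact (hB x (Ioo_subset_Icc_self hx)).trans ((le_max_right _ _).trans (le_max_right _ _))

lemma clamped_exists (m α β C t₀ x₀ : ℝ) (hm : 0 ≤ m) (hα : 0 < α) (hC : 0 ≤ C)
    (ht : t₀ ∈ Ioo α β) :
    ∃ u : ℝ → ℝ, u t₀ = x₀ ∧ ∀ t ∈ Ioo α β, HasDerivAt u (starF m t (clampF C (u t))) t := by
  obtain ⟨K, hK⟩ := clamped_lip m α C hm hα hC
  have hL : 0 ≤ (1 + C ^ 2) * (1 + (m / α) * C) := by positivity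
  have hM : 0 ≤ (1 + C ^ 2) * (1 + (m / α) * C) * max (β - t₀) (t₀ - α) :=
    mul_nonneg hL (le_max_of_le_left (by linarith [ht.2]))
  have hpl : IsPicardLindelof (fun t x => starF m t (clampF C x))
      (⟨t₀, Ioo_subset_Icc_self ht⟩ : Icc α β) x₀ ⟨_, hM⟩ 0 ⟨_, hL⟩ K := by
    refine ⟨fun t ht => (hK t ht.1).lipschitzOnWith, fun x _ => ?_, fun t ht x _ => ?_, ?_⟩
    · unfold starF
      refine continuousOn_const.mul (continuousOn_const.sub
        (continuousOn_const.div continuousOn_id fun t ht => ?_))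
      exact (hα.trans_le ht.1).ne'
    · exact starF_bound m α C t _ hm hα ht.1 (clampF_abs C x hC)
    · simp only [NNReal.coe_zero, sub_zero]
      exact le_rfl
  obtain ⟨u, hu0, hu⟩ := hpl.exists_eq_forall_mem_Icc_hasDerivWithinAt₀
  exact ⟨u, hu0, fun t ht => (hu t (Ioo_subset_Icc_self ht)).hasDerivAt (Icc_mem_nhds ht.1 ht.2)⟩

lemma lt_of_never_eq (α β t₀ t : ℝ) (f g : ℝ → ℝ) (hf : ContinuousOn f (Ioo α β))
    (hg : ContinuousOn g (Ioo α β)) (ht₀ : t₀ ∈ Ioo α β) (ht : t ∈ Ioo α β)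
    (hne : ∀ x ∈ Ioo α β, f x ≠ g x) (h : f t₀ < g t₀) : f t < g t := by
  by_contra hcon
  push Not at hcon
  obtain ⟨x, hx, hx2⟩ := isPreconnected_Ioo.intermediate_value₂ ht₀ ht hf hg h.le hcon
  exact hne x hx hx2

lemma star_exists (m α β t₀ x₀ : ℝ) (hm : 0 ≤ m) (hα : 0 < α) (ht : t₀ ∈ Ioo α β) (W : ℝ → ℝ)
    (hW : ∀ s, 0 < s → HasDerivAt W (starF m s (W s)) s) (hW1 : ∀ s, 0 < s → 1 < W s)
    (hx : 1 < x₀) (hx' : x₀ < W t₀) :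
    ∃ u : ℝ → ℝ, u t₀ = x₀ ∧ (∀ t ∈ Ioo α β, HasDerivAt u (starF m t (u t)) t) ∧
      ∀ t ∈ Ioo α β, 1 < u t ∧ u t < W t := by
  obtain ⟨C, hC⟩ := (isCompact_Icc (a := α) (b := β)).exists_bound_of_continuousOn
    (HasDerivAt.continuousOn fun x hx => hW x (hα.trans_le hx.1))
  have hC1 : 1 ≤ C := by
    have h1 := hC t₀ (Ioo_subset_Icc_self ht)
    have h2 := hW1 t₀ (hα.trans ht.1)
    rw [Real.norm_eq_abs] at h1
    linarith [le_abs_self (W t₀)]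
  obtain ⟨u, hu0, hu⟩ := clamped_exists m α β C t₀ x₀ hm hα (by linarith) ht
  have hcW : ∀ t ∈ Ioo α β, HasDerivAt W (starF m t (clampF C (W t))) t := fun t ht => by
    rw [clampF_id _ _ (hC t (Ioo_subset_Icc_self ht))]
    exact hW t (hα.trans ht.1)
  have hc1 : ∀ t ∈ Ioo α β, HasDerivAt (fun _ : ℝ => (1:ℝ)) (starF m t (clampF C 1)) t :=
    fun t ht => by
    rw [clampF_id _ _ (by simpa using hC1)]
    have : starF m t 1 = 0 := by simp [starF]
    rw [this]; exact hasDerivAt_const _ _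
  have huc : ContinuousOn u (Ioo α β) := HasDerivAt.continuousOn hu
  have key : ∀ t ∈ Ioo α β, 1 < u t ∧ u t < W t := by
    intro t ht'
    constructor
    · refine lt_of_never_eq α β t₀ t (fun _ => 1) u continuousOn_const huc ht ht' ?_
        (by rw [hu0]; exact hx)
      intro x hx3 he
      have := clamped_unique m α β C hm hα (by linarith) _ _ x hx3 hc1 hu he ht
      simp only [hu0] at this
      linarith
    · refine lt_of_never_eq α β t₀ t u W huc (HasDerivAt.continuousOn hcW) ht ht' ?_
        (by rw [hu0]; exact hx')
      intro x hx3 he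
      have := clamped_unique m α β C hm hα (by linarith) _ _ x hx3 hu hcW he ht
      rw [hu0] at this
      linarith
  refine ⟨u, hu0, fun t ht => ?_, key⟩
  have := hu t ht
  rwa [clampF_id] at this
  have h1 := hC t (Ioo_subset_Icc_self ht)
  rw [Real.norm_eq_abs] at h1
  rw [abs_le] at *
  obtain ⟨h2, h3⟩ := key t ht
  constructor <;> linarith

lemma star_global (m t₀ x₀ : ℝ) (hm : 0 ≤ m) (ht : 0 < t₀) (W : ℝ → ℝ)
    (hW : ∀ s, 0 < s → HasDerivAt W (starF m s (W s)) s) (hW1 : ∀ s, 0 < s → 1 < W s)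
    (hx : 1 < x₀) (hx' : x₀ < W t₀) :
    ∃ v : ℝ → ℝ, v t₀ = x₀ ∧ (∀ t, 0 < t → HasDerivAt v (starF m t (v t)) t) ∧
      ∀ t, 0 < t → 1 < v t ∧ v t < W t := by
  have H : ∀ k : ℝ, ∃ u : ℝ → ℝ, 0 < k → u t₀ = x₀ ∧
      (∀ t ∈ Ioo (min k t₀ / 2) (max k t₀ + 1), HasDerivAt u (starF m t (u t)) t) ∧
      ∀ t ∈ Ioo (min k t₀ / 2) (max k t₀ + 1), 1 < u t ∧ u t < W t := by
    intro k
    by_cases hk : 0 < k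
    · have h0 : 0 < min k t₀ := lt_min hk ht
      obtain ⟨u, hu⟩ := star_exists m (min k t₀ / 2) (max k t₀ + 1) t₀ x₀ hm (by linarith)
        ⟨by linarith [min_le_right k t₀], by linarith [le_max_right k t₀]⟩ W hW hW1 hx hx'
      exact ⟨u, fun _ => hu⟩
    · exact ⟨fun _ => 0, fun h => absurd h hk⟩
  choose U hU using H
  have mem : ∀ k, 0 < k → k ∈ Ioo (min k t₀ / 2) (max k t₀ + 1) := fun k hk => by
    have h0 : 0 < min k t₀ := lt_min hk ht
    exact ⟨by linarith [min_le_left k t₀], by linarith [le_max_left k t₀]⟩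
  have mem0 : ∀ k, 0 < k → t₀ ∈ Ioo (min k t₀ / 2) (max k t₀ + 1) := fun k hk => by
    have h0 : 0 < min k t₀ := lt_min hk ht
    exact ⟨by linarith [min_le_right k t₀], by linarith [le_max_right k t₀]⟩
  have agree : ∀ k, 0 < k → ∀ t ∈ Ioo (min k t₀ / 2) (max k t₀ + 1), U t t = U k t := by
    intro k hk t htt
    have h0 : 0 < min k t₀ := lt_min hk ht
    have ht0 : 0 < t := by linarith [htt.1]
    have h0' : 0 < min t t₀ := lt_min ht0 ht
    refine star_unique m (max (min k t₀ / 2) (min t t₀ / 2)) (min (max k t₀ + 1) (max t t₀ + 1))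
      hm (le_max_of_le_left (by linarith)) (U t) (U k) t₀ ?_ ?_ ?_ ?_ ?_
    · exact ⟨max_lt (mem0 k hk).1 (mem0 t ht0).1, lt_min (mem0 k hk).2 (mem0 t ht0).2⟩
    · intro x hx
      exact (hU t ht0).2.1 x ⟨(le_max_right _ _).trans_lt hx.1, hx.2.trans_le (min_le_right _ _)⟩
    · intro x hx
      exact (hU k hk).2.1 x ⟨(le_max_left _ _).trans_lt hx.1, hx.2.trans_le (min_le_left _ _)⟩
    · rw [(hU t ht0).1, (hU k hk).1]
    · exact ⟨max_lt htt.1 (mem t ht0).1, lt_min htt.2 (mem t ht0).2⟩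
  refine ⟨fun t => U t t, (hU t₀ ht).1, fun t htp => ?_, fun t htp => (hU t htp).2.2 t (mem t htp)⟩
  refine ((hU t htp).2.1 t (mem t htp)).congr_of_eventuallyEq ?_
  filter_upwards [Ioo_mem_nhds (mem t htp).1 (mem t htp).2] with x hx
  exact agree t htp x hx

lemma star_exists_le (m : ℝ) (hm : 1 ≤ m) (W v : ℝ → ℝ)
    (hW : ∀ s, 0 < s → HasDerivAt W (starF m s (W s)) s)
    (hv : ∀ s, 0 < s → HasDerivAt v (starF m s (v s)) s)
    (hvW : ∀ s, 0 < s → 1 < v s ∧ v s < W s) :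
    ∃ s, m ≤ s ∧ v s - s / m ≤ 0 := by
  by_contra hcon
  push Not at hcon
  have hd : ∀ s, m ≤ s → 0 < W s - v s := fun s hs => by linarith [(hvW s (by linarith)).2]
  have hder : ∀ s, m ≤ s → HasDerivAt (fun s => (W s - v s)⁻¹ + 2 * s)
      (-(starF m s (W s) - starF m s (v s)) / (W s - v s) ^ 2 + 2) s := fun s hs => by
    have h0 : 0 < s := by linarith
    have := (((hW s h0).sub (hv s h0)).inv (hd s hs).ne').add ((hasDerivAt_id s).const_mul 2)
    rw [mul_one] at this
    exact this
  have hle : ∀ s, m ≤ s →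
      -(starF m s (W s) - starF m s (v s)) / (W s - v s) ^ 2 + 2 ≤ 0 := fun s hs => by
    have h0 : 0 < s := by linarith
    have hdp := hd s hs
    have hg := hcon s hs
    obtain ⟨hv1, -⟩ := hvW s h0
    have hsm : 1 ≤ s / m := by rw [le_div_iff₀ (by linarith)]; linarith
    have hq : 0 < m / s := by positivity
    have hqr : (m / s) * (s / m) = 1 := by field_simp
    have e : starF m s (W s) - starF m s (v s) =
        (W s ^ 2 - 1) * (m / s) * (W s - v s) + (W s ^ 2 - v s ^ 2) * ((m / s) * v s - 1) := by
      unfold starF; ring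
    have h1 : 0 ≤ (m / s) * v s - 1 := by
      have := mul_le_mul_of_nonneg_left (sub_pos.1 hg).le hq.le
      linarith
    have h2 : 0 ≤ (W s ^ 2 - v s ^ 2) * ((m / s) * v s - 1) :=
      mul_nonneg (by nlinarith) h1
    have h3 : 2 * (s / m) * (W s - v s) ≤ W s ^ 2 - 1 := by nlinarith
    have h4 : 2 * (W s - v s) ≤ (W s ^ 2 - 1) * (m / s) := by
      have := mul_le_mul_of_nonneg_right h3 hq.le
      have e2 : 2 * (s / m) * (W s - v s) * (m / s) = 2 * (W s - v s) * ((m / s) * (s / m)) := by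
        ring
      rw [e2, hqr] at this
      linarith
    have h5 : 2 * (W s - v s) ^ 2 ≤ starF m s (W s) - starF m s (v s) := by
      rw [e]
      have := mul_le_mul_of_nonneg_right h4 hdp.le
      nlinarith
    have h6 : 2 ≤ (starF m s (W s) - starF m s (v s)) / (W s - v s) ^ 2 := by
      rw [le_div_iff₀ (by positivity)]; exact h5
    rw [neg_div]; linarith
  have hanti : AntitoneOn (fun s => (W s - v s)⁻¹ + 2 * s) (Ici m) := by
    refine antitoneOn_of_deriv_nonpos (convex_Ici m)
      (HasDerivAt.continuousOn fun s hs => hder s hs)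
      (fun s hs => ?_) (fun s hs => ?_)
    · exact (hder s (interior_subset hs)).differentiableAt.differentiableWithinAt
    · rw [(hder s (interior_subset hs)).deriv]; exact hle s (interior_subset hs)
  have hi : 0 < (W m - v m)⁻¹ := inv_pos.2 (hd m le_rfl)
  have := hanti (a := m) (b := m + (W m - v m)⁻¹) self_mem_Ici
    (by simp only [mem_Ici]; linarith) (by linarith)
  have h7 : 0 < (W (m + (W m - v m)⁻¹) - v (m + (W m - v m)⁻¹))⁻¹ :=
    inv_pos.2 (hd _ (by linarith))
  simp only at this
  linarith

lemma g_neg_after (m : ℝ) (hm : 1 ≤ m) (v : ℝ → ℝ)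
    (hv : ∀ s, 0 < s → HasDerivAt v (starF m s (v s)) s)
    (hv1 : ∀ s, 0 < s → 1 < v s) (s₁ : ℝ) (h1 : 0 < s₁) (hg : v s₁ - s₁ / m ≤ 0)
    (t : ℝ) (ht : s₁ < t) : v t - t / m < 0 := by
  have hder : ∀ s, 0 < s → HasDerivAt (fun s => v s - s / m) (starF m s (v s) - 1 / m) s :=
    fun s hs => (hv s hs).sub ((hasDerivAt_id s).div_const m)
  have hmi : 0 < 1 / m := by positivity
  have e : ∀ s, 0 < s → starF m s (v s) = (v s ^ 2 - 1) * (m / s) * (v s - s / m) := by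
    intro s hs
    have hm0 : m ≠ 0 := by linarith
    unfold starF; field_simp; ring
  have hle : ∀ x ∈ Icc s₁ t, v x - x / m ≤ 0 := by
    intro x hx
    refine image_le_of_deriv_right_lt_deriv_boundary (a := s₁) (b := t)
      (f := fun s => v s - s / m) (f' := fun s => starF m s (v s) - 1 / m) (B := fun _ => 0)
      (B' := fun _ => 0) ?_ ?_ hg (fun x => hasDerivAt_const _ _) ?_ hx
    · exact HasDerivAt.continuousOn fun s hs => hder s (h1.trans_le hs.1)
    · exact fun s hs => (hder s (h1.trans_le hs.1)).hasDerivWithinAt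
    · intro s hs h
      rw [e s (h1.trans_le hs.1), h]
      linarith
  have hanti : StrictAntiOn (fun s => v s - s / m) (Icc s₁ t) := by
    refine strictAntiOn_of_deriv_neg (convex_Icc _ _)
      (HasDerivAt.continuousOn fun s hs => hder s (h1.trans_le hs.1)) fun s hs => ?_
    have hs := interior_subset hs
    have hs0 := h1.trans_le hs.1
    rw [(hder s hs0).deriv, e s hs0]
    have h3 := hle s hs
    have h4 := hv1 s hs0
    have h5 : 0 ≤ (v s ^ 2 - 1) * (m / s) := mul_nonneg (by nlinarith) (by positivity)
    nlinarith [mul_nonneg h5 (neg_nonneg.2 h3)]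
  have := hanti (left_mem_Icc.2 ht.le) (right_mem_Icc.2 ht.le) ht
  simp only at this
  linarith

lemma tendsto_top (m : ℝ) (hm : 1 ≤ m) (v : ℝ → ℝ)
    (hv : ∀ s, 0 < s → HasDerivAt v (starF m s (v s)) s)
    (hv1 : ∀ s, 0 < s → 1 < v s) (s₁ : ℝ) (h1 : 0 < s₁)
    (hg : ∀ t, s₁ ≤ t → v t - t / m ≤ 0) : Tendsto v atTop (nhds 1) := by
  have hfac : ∀ t, s₁ ≤ t → 0 ≤ 1 - m * v t / t := by
    intro t ht
    have h0 : 0 < t := by linarith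
    have h2 := hg t ht
    have h3 : v t ≤ t / m := by linarith
    rw [le_div_iff₀ (by linarith)] at h3
    rw [sub_nonneg, div_le_one h0]; linarith
  have hanti : AntitoneOn v (Ici s₁) := by
    refine antitoneOn_of_deriv_nonpos (convex_Ici _)
      (HasDerivAt.continuousOn fun s hs => hv s (h1.trans_le hs))
      (fun s hs => (hv s (h1.trans_le (interior_subset hs))).differentiableAt.differentiableWithinAt)
      fun s hs => ?_
    have hs : s₁ ≤ s := interior_subset hs
    have hs0 := h1.trans_le hs
    rw [(hv s hs0).deriv]
    unfold starF
    have := hv1 s hs0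
    exact mul_nonpos_of_nonpos_of_nonneg (by nlinarith) (hfac s hs)
  have key : ∀ ε > 0, ∃ t, s₁ ≤ t ∧ v t < 1 + ε := by
    intro ε hε
    by_contra hcon
    push Not at hcon
    set S := max s₁ (2 * m * v s₁) with hS
    have hS1 : s₁ ≤ S := le_max_left _ _
    have hder : ∀ s, S ≤ s → HasDerivAt (fun s => v s + ε * s) (starF m s (v s) + ε) s :=
      fun s hs => by
      have := (hv s (by linarith)).add ((hasDerivAt_id s).const_mul ε)
      rw [mul_one] at this
      exact this
    have hA : AntitoneOn (fun s => v s + ε * s) (Ici S) := by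
      refine antitoneOn_of_deriv_nonpos (convex_Ici _)
        (HasDerivAt.continuousOn fun s hs => hder s hs)
        (fun s hs => (hder s (interior_subset hs)).differentiableAt.differentiableWithinAt)
        fun s hs => ?_
      have hs : S ≤ s := interior_subset hs
      have hs0 : 0 < s := by linarith
      rw [(hder s hs).deriv]
      have h2 := hcon s (hS1.trans hs)
      have h3 : v s ≤ v s₁ := hanti self_mem_Ici (hS1.trans hs) (hS1.trans hs)
      have h4 : 2 * m * v s₁ ≤ s := (le_max_right _ _).trans hs
      have h5 : m * v s / s ≤ 1 / 2 := by
        rw [div_le_iff₀ hs0]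
        have := mul_le_mul_of_nonneg_left h3 (by linarith : 0 ≤ m)
        linarith
      unfold starF
      have h6 : 2 * ε ≤ v s ^ 2 - 1 := by nlinarith
      nlinarith
    have hvS : 1 < v S := hv1 S (by linarith)
    have hp : 0 < v S / ε := by positivity
    have := hA (a := S) (b := S + v S / ε) self_mem_Ici
      (by simp only [mem_Ici]; linarith) (by linarith)
    simp only at this
    have h8 := hv1 (S + v S / ε) (by linarith)
    have h9 : ε * (S + v S / ε) = ε * S + v S := by field_simp
    linarith
  rw [Metric.tendsto_atTop]
  intro ε hε
  obtain ⟨t, ht, htv⟩ := key ε hε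
  refine ⟨t, fun s hs => ?_⟩
  have h2 := hv1 s (by linarith)
  have h3 : v s ≤ v t := hanti ht (ht.trans hs) hs
  rw [Real.dist_eq, abs_lt]
  constructor <;> linarith

lemma tendsto_zero (m : ℝ) (hm : 1 ≤ m) (v : ℝ → ℝ)
    (hv : ∀ s, 0 < s → HasDerivAt v (starF m s (v s)) s)
    (hv1 : ∀ s, 0 < s → 1 < v s) (s₁ : ℝ) (h1 : 0 < s₁)
    (hg : ∀ t, 0 < t → t ≤ s₁ → 0 ≤ v t - t / m) :
    Tendsto v (nhdsWithin 0 (Ioi 0)) (nhds 1) := by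
  have hfac : ∀ t, 0 < t → t ≤ s₁ → 0 ≤ m * v t / t - 1 := by
    intro t h0 ht
    have h2 := hg t h0 ht
    have h3 : t / m ≤ v t := by linarith
    rw [div_le_iff₀ (by linarith)] at h3
    rw [sub_nonneg, one_le_div h0]; linarith
  have hmono : MonotoneOn v (Ioc 0 s₁) := by
    refine monotoneOn_of_deriv_nonneg (convex_Ioc _ _)
      (HasDerivAt.continuousOn fun s hs => hv s hs.1)
      (fun s hs => (hv s (interior_subset hs).1).differentiableAt.differentiableWithinAt)
      fun s hs => ?_
    have hs := interior_subset hs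
    rw [(hv s hs.1).deriv]
    have h2 := hv1 s hs.1
    have h3 := hfac s hs.1 hs.2
    have h4 : 0 ≤ (v s ^ 2 - 1) * (m * v s / s - 1) := mul_nonneg (by nlinarith) h3
    unfold starF
    linarith
  have key : ∀ ε > 0, ∃ t, 0 < t ∧ t ≤ s₁ ∧ v t < 1 + ε := by
    intro ε hε
    by_contra hcon
    push Not at hcon
    have hder : ∀ s, 0 < s → HasDerivAt (fun s => v s - ε * (Real.log s - s))
        (starF m s (v s) - ε * (s⁻¹ - 1)) s := fun s hs =>
      (hv s hs).sub (((Real.hasDerivAt_log hs.ne').sub (hasDerivAt_id s)).const_mul ε)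
    have hM : MonotoneOn (fun s => v s - ε * (Real.log s - s)) (Ioc 0 s₁) := by
      refine monotoneOn_of_deriv_nonneg (convex_Ioc _ _)
        (HasDerivAt.continuousOn fun s hs => hder s hs.1)
        (fun s hs => (hder s (interior_subset hs).1).differentiableAt.differentiableWithinAt)
        fun s hs => ?_
      have hs := interior_subset hs
      have hs0 := hs.1
      rw [(hder s hs.1).deriv]
      have h2 := hcon s hs.1 hs.2
      have h3 := hfac s hs.1 hs.2
      have h4 : ε ≤ v s ^ 2 - 1 := by nlinarith
      have h5 := mul_le_mul_of_nonneg_right h4 h3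
      have h6 : s⁻¹ ≤ m * v s / s := by
        rw [inv_eq_one_div]
        exact div_le_div_of_nonneg_right (by nlinarith) hs0.le
      have h7 : ε * (s⁻¹ - 1) ≤ ε * (m * v s / s - 1) :=
        mul_le_mul_of_nonneg_left (by linarith) hε.le
      unfold starF
      linarith
    -- choose s small
    set D := (v s₁ - ε * (Real.log s₁ - s₁)) / ε with hD
    have hDe : ε * D = v s₁ - ε * (Real.log s₁ - s₁) := by rw [hD]; field_simp
    set s := min s₁ (Real.exp (-D)) with hs
    have hs0 : 0 < s := lt_min h1 (Real.exp_pos _)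
    have := hM (a := s) (b := s₁) ⟨hs0, min_le_left _ _⟩ ⟨h1, le_rfl⟩ (min_le_left _ _)
    simp only at this
    rw [← hDe] at this
    have hl : Real.log s ≤ -D := by
      rw [Real.log_le_iff_le_exp hs0]; exact min_le_right _ _
    have h2 := hv1 s hs0
    nlinarith [mul_le_mul_of_nonneg_left hl hε.le, mul_pos hε hs0]
  rw [Metric.tendsto_nhdsWithin_nhds]
  intro ε hε
  obtain ⟨t, ht0, ht, htv⟩ := key ε hε
  refine ⟨t, ht0, fun s hs hst => ?_⟩
  have hs0 : 0 < s := hs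
  rw [Real.dist_eq, sub_zero, abs_of_pos hs0] at hst
  have h2 := hv1 s hs0
  have h3 : v s ≤ v t := hmono ⟨hs0, hst.le.trans ht⟩ ⟨ht0, ht⟩ hst.le
  rw [Real.dist_eq, abs_lt]
  constructor <;> linarith



/-- **Case VI, classification.** If `W = 𝐰` is the unique global solution
of `(★)` above `1` with no critical points, then any solution `w` with
`1 < w(s₀) < W(s₀)` at some point extends to a global solution `v` on `(0,∞)` with
`1 < v < W` everywhere, exactly one critical point `s₁` (where `v(s₁) = s₁/(n-1)`),
and `v → 1` both at `+∞` and at `0⁺`. -/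
theorem solution_below_asymptotic_solution (n : ℕ) (hn : 2 ≤ n) (W : ℝ → ℝ)
    -- W is the distinguished solution 𝐰
    (hWode : ∀ s : ℝ, 0 < s →
      HasDerivAt W ((1 - W s ^ 2) * (1 - (n - 1 : ℝ) * W s / s)) s)
    (hWabove : ∀ s : ℝ, 0 < s → 1 < W s)
    (hWnocrit : ∀ s : ℝ, 0 < s → deriv W s ≠ 0)
    -- w is a solution on an interval `(a,b) ⊆ (0,∞)` around `s₀`
    (a b s₀ : ℝ) (ha : 0 ≤ a) (has₀ : a < s₀) (hs₀b : s₀ < b) (w : ℝ → ℝ)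
    (hode : ∀ s ∈ Set.Ioo a b,
      HasDerivAt w ((1 - w s ^ 2) * (1 - (n - 1 : ℝ) * w s / s)) s)
    (hlow : 1 < w s₀) (hup : w s₀ < W s₀) :
    ∃ v : ℝ → ℝ,
      Set.EqOn v w (Set.Ioo a b) ∧
      (∀ s : ℝ, 0 < s →
        HasDerivAt v ((1 - v s ^ 2) * (1 - (n - 1 : ℝ) * v s / s)) s) ∧
      (∀ s : ℝ, 0 < s → 1 < v s ∧ v s < W s) ∧
      (∃! s₁ : ℝ, 0 < s₁ ∧ deriv v s₁ = 0) ∧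
      (∀ s₁ : ℝ, 0 < s₁ → deriv v s₁ = 0 → v s₁ = s₁ / (n - 1 : ℝ)) ∧
      Tendsto v atTop (nhds 1) ∧
      Tendsto v (nhdsWithin 0 (Set.Ioi 0)) (nhds 1) := by
  have hm : (1 : ℝ) ≤ (n - 1 : ℝ) := by
    have : (2 : ℝ) ≤ n := by exact_mod_cast hn
    linarith
  have hW : ∀ s, 0 < s → HasDerivAt W (starF (n - 1 : ℝ) s (W s)) s := hWode
  have hw : ∀ s ∈ Ioo a b, HasDerivAt w (starF (n - 1 : ℝ) s (w s)) s := hode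
  have hs₀ : 0 < s₀ := by linarith
  obtain ⟨v, hv0, hv, hvb⟩ := star_global (n - 1 : ℝ) s₀ (w s₀) (by linarith) hs₀ W hW hWabove
    hlow hup
  generalize (n - 1 : ℝ) = m at *
  have hv1 : ∀ s, 0 < s → 1 < v s := fun s hs => (hvb s hs).1
  have hcrit : ∀ s, 0 < s → (deriv v s = 0 ↔ v s = s / m) := by
    intro s hs
    rw [(hv s hs).deriv]
    have h1 := hv1 s hs
    have h2 : (1 - v s ^ 2) ≠ 0 := by nlinarith
    unfold starF
    rw [mul_eq_zero, or_iff_right h2, sub_eq_zero, eq_div_iff (by linarith : m ≠ 0),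
      eq_div_iff hs.ne', one_mul]
    constructor <;> intro h <;> linarith
  obtain ⟨s₂, hms₂, hs₂⟩ := star_exists_le m hm W v hW hv hvb
  have hm0 : 0 < m := by linarith
  obtain ⟨s₁, hs₁, hgs₁⟩ : ∃ s₁, 0 < s₁ ∧ v s₁ = s₁ / m := by
    have hc : ContinuousOn (fun s => v s - s / m) (Icc m s₂) :=
      HasDerivAt.continuousOn fun s hs =>
        (hv s (hm0.trans_le hs.1)).sub ((hasDerivAt_id s).div_const m)
    have hgm : 0 ≤ v m - m / m := by
      rw [div_self hm0.ne']; linarith [hv1 m hm0]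
    obtain ⟨x, hx, hx0⟩ := intermediate_value_Icc' hms₂ hc ⟨hs₂, hgm⟩
    exact ⟨x, hm0.trans_le hx.1, sub_eq_zero.1 hx0⟩
  refine ⟨v, ?_, hv, hvb, ⟨s₁, ⟨hs₁, (hcrit s₁ hs₁).2 hgs₁⟩, ?_⟩,
    fun s hs h => (hcrit s hs).1 h, ?_, ?_⟩
  · exact star_unique m a b hm0.le ha v w s₀ ⟨has₀, hs₀b⟩ (fun t ht => hv t (ha.trans_lt ht.1))
      hw hv0
  · rintro y ⟨hy, hyd⟩
    have hyd := (hcrit y hy).1 hyd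
    rcases lt_trichotomy y s₁ with h | h | h
    · have := g_neg_after m hm v hv hv1 y hy (by linarith) s₁ h
      linarith
    · exact h
    · have := g_neg_after m hm v hv hv1 s₁ hs₁ (by linarith) y h
      linarith
  · refine tendsto_top m hm v hv hv1 s₁ hs₁ fun t ht => ?_
    rcases ht.eq_or_lt with h | h
    · rw [← h]; linarith
    · exact (g_neg_after m hm v hv hv1 s₁ hs₁ (by linarith) t h).le
  · refine tendsto_zero m hm v hv hv1 s₁ hs₁ fun t ht hts => ?_
    by_contra hneg
    push Not at hneg
    rcases hts.eq_or_lt with h | h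
    · rw [h] at hneg; linarith
    · have := g_neg_after m hm v hv hv1 t ht hneg.le s₁ h
      linarith
end

section
/- Let n ≥ 2 be a natural number, let 𝐰 : (0,∞) → ℝ be the unique solution of (★) on (0,∞) with 𝐰 > 1 everywhere and no critical points, and let w be a solution of (★) with w(s₀) > 𝐰(s₀) at some s₀ > 0. Then the maximal solution extending w is defined exactly on an interval (0, s₁) with s₀ < s₁ < ∞, satisfies w(s) > 𝐰(s) for all s in its domain, has no critical points, and satisfies w(s) → +∞ as s → s₁⁻ (finite-time blow-up). -/
open Set Filter

noncomputable def fld (k s x : ℝ) : ℝ := (1 - x ^ 2) * (1 - k * x / s)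

def LocLip (G : ℝ → ℝ → ℝ) : Prop :=
  ∀ c d R : ℝ, 0 < c → 0 ≤ R → ∃ K : NNReal, ∀ t ∈ Icc c d, LipschitzOnWith K (G t) (Icc (-R) R)

noncomputable def clampW (W : ℝ → ℝ) (M s x : ℝ) : ℝ := max (W s) (min x M)

lemma fld_locLip (k : ℝ) (hk : 0 < k) : LocLip (fld k) := by
  intro c d R hc hR
  refine ⟨⟨2 * R + k / c * (1 + 3 * R ^ 2), by positivity⟩, fun t ht => ?_⟩
  apply LipschitzOnWith.of_dist_le_mul
  intro x hx y hy
  have ht0 : 0 < t := lt_of_lt_of_le hc ht.1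
  have e : fld k t x - fld k t y
      = (-(x + y) - (k / t) * (1 - (x ^ 2 + x * y + y ^ 2))) * (x - y) := by
    unfold fld; field_simp; ring
  rw [Real.dist_eq, Real.dist_eq, e, abs_mul]
  apply mul_le_mul_of_nonneg_right _ (abs_nonneg _)
  have hx' : |x| ≤ R := abs_le.2 hx
  have hy' : |y| ≤ R := abs_le.2 hy
  have hx2 : |x ^ 2| ≤ R ^ 2 := by rw [abs_pow]; gcongr
  have hy2 : |y ^ 2| ≤ R ^ 2 := by rw [abs_pow]; gcongr
  have hxy : |x * y| ≤ R ^ 2 := by rw [abs_mul, sq]; gcongr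
  have h1 : |1 - (x ^ 2 + x * y + y ^ 2)| ≤ 1 + 3 * R ^ 2 := by
    rw [abs_le] at *; constructor <;> linarith [hx2.1, hx2.2]
  have h2 : |x + y| ≤ 2 * R := by
    rw [abs_le] at *; constructor <;> linarith [hx'.1, hx'.2]
  have h3 : k / t ≤ k / c := by gcongr; exact ht.1
  have h4 : |k / t * (1 - (x ^ 2 + x * y + y ^ 2))| ≤ k / c * (1 + 3 * R ^ 2) := by
    rw [abs_mul, abs_of_pos (by positivity : 0 < k / t)]; gcongr
  calc _ ≤ |-(x + y)| + |k / t * (1 - (x ^ 2 + x * y + y ^ 2))| := abs_sub _ _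
    _ ≤ _ := by rw [abs_neg]; exact add_le_add h2 h4

lemma clampW_lip (W : ℝ → ℝ) (M s : ℝ) : LipschitzWith 1 (clampW W M s) :=
  (LipschitzWith.id.min_const M).const_max (W s)

lemma clampW_bdd (W : ℝ → ℝ) (hW : ContinuousOn W (Ioi 0)) (M c d : ℝ) (hc : 0 < c) :
    ∃ R, 0 ≤ R ∧ ∀ t ∈ Icc c d, ∀ x, clampW W M t x ∈ Icc (-R) R := by
  obtain ⟨C, hC⟩ := (isCompact_Icc (a := c) (b := d)).exists_bound_of_continuousOn
    (hW.mono fun t ht => lt_of_lt_of_le hc ht.1)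
  refine ⟨|C| + |M|, by positivity, fun t ht x => ?_⟩
  have h := abs_le.1 ((hC t ht).trans (le_abs_self C))
  have h1 := abs_nonneg C
  have h2 := abs_nonneg M
  have h3 := le_abs_self M
  unfold clampW
  constructor
  · exact le_max_of_le_left (by linarith [h.1])
  · apply max_le (by linarith [h.2])
    exact (min_le_right _ _).trans (by linarith)

lemma clamp_locLip (k : ℝ) (hk : 0 < k) (W : ℝ → ℝ) (hW : ContinuousOn W (Ioi 0)) (M : ℝ) (c d : ℝ)
    (hc : 0 < c) : ∃ K : NNReal, ∀ t ∈ Icc c d,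
      LipschitzWith K (fun x => fld k t (clampW W M t x)) := by
  obtain ⟨R, hR, h⟩ := clampW_bdd W hW M c d hc
  obtain ⟨K, hK⟩ := fld_locLip k hk c d R hc hR
  refine ⟨K, fun t ht => ?_⟩
  have := (hK t ht).comp (f := clampW W M t) (s := univ) (clampW_lip W M t).lipschitzOnWith
    (fun x _ => h t ht x)
  rw [mul_one] at this
  exact lipschitzOnWith_univ.1 this

lemma uniq (G : ℝ → ℝ → ℝ) (hG : LocLip G) (c d t0 : ℝ) (hc : 0 ≤ c) (ht0 : t0 ∈ Ioo c d)
    (f g : ℝ → ℝ) (hf : ∀ s ∈ Ioo c d, HasDerivAt f (G s (f s)) s)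
    (hg : ∀ s ∈ Ioo c d, HasDerivAt g (G s (g s)) s) (h0 : f t0 = g t0) :
    EqOn f g (Ioo c d) := by
  intro t ht
  obtain ⟨c', hc1, hc2⟩ := exists_between (lt_min ht.1 ht0.1)
  obtain ⟨d', hd1, hd2⟩ := exists_between (max_lt ht.2 ht0.2)
  have sub : Icc c' d' ⊆ Ioo c d := fun s hs => ⟨hc1.trans_le hs.1, hs.2.trans_lt hd2⟩
  obtain ⟨A, hA⟩ := (isCompact_Icc (a := c') (b := d')).exists_bound_of_continuousOn
    (HasDerivAt.continuousOn fun s hs => hf s (sub hs))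
  obtain ⟨B, hB⟩ := (isCompact_Icc (a := c') (b := d')).exists_bound_of_continuousOn
    (HasDerivAt.continuousOn fun s hs => hg s (sub hs))
  obtain ⟨K, hK⟩ := hG c' d' (|A| + |B|) (hc.trans_lt hc1) (by positivity)
  have hc2' := lt_min_iff.1 hc2
  have hd1' := max_lt_iff.1 hd1
  refine ODE_solution_unique_of_mem_Ioo (v := G) (s := fun _ => Icc (-(|A| + |B|)) (|A| + |B|))
    (K := K) (a := c') (b := d') (t₀ := t0) (fun s hs => hK s (Ioo_subset_Icc_self hs))
    ⟨hc2'.2, hd1'.2⟩ ?_ ?_ h0 ⟨hc2'.1, hd1'.1⟩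
  · intro s hs
    have hs := Ioo_subset_Icc_self hs
    exact ⟨hf s (sub hs), abs_le.1 ((hA s hs).trans (by linarith [le_abs_self A, abs_nonneg B]))⟩
  · intro s hs
    have hs := Ioo_subset_Icc_self hs
    exact ⟨hg s (sub hs), abs_le.1 ((hB s hs).trans (by linarith [le_abs_self B, abs_nonneg A]))⟩

lemma compare (G : ℝ → ℝ → ℝ) (hG : LocLip G) (c d t0 : ℝ) (hc : 0 ≤ c) (ht0 : t0 ∈ Ioo c d)
    (f g : ℝ → ℝ) (hf : ∀ s ∈ Ioo c d, HasDerivAt f (G s (f s)) s)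
    (hg : ∀ s ∈ Ioo c d, HasDerivAt g (G s (g s)) s) (h0 : f t0 < g t0) :
    ∀ s ∈ Ioo c d, f s < g s := by
  intro s hs
  by_contra hcon
  push Not at hcon
  have hcont : ContinuousOn (fun s => g s - f s) (Ioo c d) :=
    (HasDerivAt.continuousOn hg).sub (HasDerivAt.continuousOn hf)
  have := isPreconnected_Ioo.intermediate_value hs ht0 hcont
  obtain ⟨r, hr, hr0⟩ := this (show (0:ℝ) ∈ Icc _ _ from ⟨by linarith, by linarith⟩)
  have := uniq G hG c d r hc hr f g hf hg (by simp only at hr0; linarith) ht0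
  linarith

lemma W_super (k : ℝ) (hk : 0 < k) (W : ℝ → ℝ)
    (hWode : ∀ s : ℝ, 0 < s → HasDerivAt W (fld k s (W s)) s)
    (hWabove : ∀ s : ℝ, 0 < s → 1 < W s)
    (hWnocrit : ∀ s : ℝ, 0 < s → deriv W s ≠ 0) : ∀ s, 0 < s → s < k * W s := by
  intro s hs
  by_contra hcon
  push Not at hcon
  have hcont : ContinuousOn (fun s => k * W s - s) (Ioi 0) :=
    (continuousOn_const.mul (HasDerivAt.continuousOn fun s hs => hWode s hs)).sub continuousOn_id
  have hk2 : 0 < k / 2 := by positivity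
  have h1 : 0 ≤ k * W (k / 2) - k / 2 := by nlinarith [hWabove _ hk2]
  obtain ⟨r, hr, hr0⟩ := isPreconnected_Ioi.intermediate_value (mem_Ioi.2 hs) (mem_Ioi.2 hk2) hcont
    (show (0:ℝ) ∈ Icc _ _ from ⟨by linarith, h1⟩)
  have hr : 0 < r := hr
  apply hWnocrit r hr
  rw [(hWode r hr).deriv]
  have : k * W r = r := by simp only at hr0; linarith
  simp [fld, this, hr.ne']

lemma fld_pos (k s x : ℝ) (hs : 0 < s) (hx : 1 < x) (h : s < k * x) : 0 < fld k s x := by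
  unfold fld
  apply mul_pos_of_neg_of_neg
  · nlinarith
  · rw [sub_neg, lt_div_iff₀ hs]; linarith

lemma bound (k : ℝ) (hk : 0 < k) (W v : ℝ → ℝ) (d s0 : ℝ) (hs0 : 0 < s0)
    (hWode : ∀ s : ℝ, 0 < s → HasDerivAt W (fld k s (W s)) s)
    (hWabove : ∀ s : ℝ, 0 < s → 1 < W s)
    (hWs : ∀ s, 0 < s → s < k * W s)
    (hv : ∀ s ∈ Ico s0 d, HasDerivAt v (fld k s (v s)) s)
    (hvW : ∀ s ∈ Ico s0 d, W s < v s) :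
    ∀ t ∈ Ico s0 d, t ≤ Real.exp ((((v s0 - W s0) ^ 2)⁻¹ + 2 * k * Real.log s0) / (2 * k)) := by
  intro t ht
  have hder : ∀ s ∈ Ico s0 d, HasDerivAt (fun s => ((v s - W s) ^ 2)⁻¹ + 2 * k * Real.log s)
      (-(2 * (v s - W s) * (fld k s (v s) - fld k s (W s))) / ((v s - W s) ^ 2) ^ 2
        + 2 * k * s⁻¹) s := by
    intro s hs
    have hsp : 0 < s := hs0.trans_le hs.1
    have hu : 0 < v s - W s := sub_pos.2 (hvW s hs)
    have h1 := (((hv s hs).sub (hWode s hsp)).pow 2).inv (by simpa using hu.ne')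
    have h2 := (Real.hasDerivAt_log hsp.ne').const_mul (2 * k)
    refine (h1.add h2).congr_deriv ?_
    simp
  have hanti : AntitoneOn (fun s => ((v s - W s) ^ 2)⁻¹ + 2 * k * Real.log s) (Ico s0 d) := by
    apply antitoneOn_of_deriv_nonpos (convex_Ico _ _) (HasDerivAt.continuousOn hder)
    · intro s hs
      exact (hder s (interior_subset hs)).differentiableAt.differentiableWithinAt
    · intro s hs
      have hs := interior_subset hs
      rw [(hder s hs).deriv]
      have hsp : 0 < s := hs0.trans_le hs.1
      have hu : 0 < v s - W s := sub_pos.2 (hvW s hs)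
      have hW1 := hWabove s hsp
      have hW2 := hWs s hsp
      have key : k * (v s - W s) ^ 3 / s ≤ fld k s (v s) - fld k s (W s) := by
        have e : fld k s (v s) - fld k s (W s) =
          (((v s) ^ 2 - 1) * k * (v s - W s) + ((v s) ^ 2 - (W s) ^ 2) * (k * W s - s)) / s := by
          unfold fld; field_simp; ring
        rw [e]
        apply div_le_div_of_nonneg_right _ hsp.le
        have a1 : 0 ≤ ((v s) ^ 2 - (W s) ^ 2) * (k * W s - s) :=
          mul_nonneg (by nlinarith) (by linarith)
        have a2 : (v s - W s) ^ 2 ≤ v s ^ 2 - 1 := by nlinarith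
        have a3 := mul_le_mul_of_nonneg_right a2 (mul_pos hk hu).le
        nlinarith
      have : 2 * (v s - W s) * (k * (v s - W s) ^ 3 / s) / ((v s - W s) ^ 2) ^ 2
          ≤ 2 * (v s - W s) * (fld k s (v s) - fld k s (W s)) / ((v s - W s) ^ 2) ^ 2 := by
        gcongr
      have e2 : 2 * (v s - W s) * (k * (v s - W s) ^ 3 / s) / ((v s - W s) ^ 2) ^ 2
        = 2 * k * s⁻¹ := by field_simp
      rw [neg_div]; linarith
  have h := hanti ⟨le_rfl, ht.1.trans_lt ht.2⟩ ht ht.1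
  have htp : 0 < t := hs0.trans_le ht.1
  rw [← Real.log_le_iff_le_exp htp, le_div_iff₀ (by positivity)]
  have : 0 ≤ ((v t - W t) ^ 2)⁻¹ := by positivity
  simp only at h
  linarith

lemma trunc_exists (k : ℝ) (hk : 0 < k) (W : ℝ → ℝ) (hW : ContinuousOn W (Ioi 0))
    (M c d s0 x0 : ℝ) (hc : 0 < c) (hs : s0 ∈ Ioo c d) :
    ∃ V : ℝ → ℝ, V s0 = x0 ∧
      ∀ s ∈ Ioo c d, HasDerivAt V (fld k s (clampW W M s (V s))) s := by
  obtain ⟨K, hK⟩ := clamp_locLip k hk W hW M c d hc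
  have hcont : ∀ x, ContinuousOn (fun s => fld k s (clampW W M s x)) (Icc c d) := by
    intro x
    have hW' : ContinuousOn W (Icc c d) := hW.mono fun t ht => lt_of_lt_of_le hc ht.1
    have h1 : ContinuousOn (fun s => clampW W M s x) (Icc c d) := by
      unfold clampW; exact hW'.sup continuousOn_const
    unfold fld
    exact (continuousOn_const.sub (h1.pow 2)).mul (continuousOn_const.sub
      ((continuousOn_const.mul h1).div continuousOn_id fun t ht => (hc.trans_le ht.1).ne'))
  obtain ⟨R, hR, hb⟩ := clampW_bdd W hW M c d hc
  have hbd : ∃ L : NNReal, ∀ t ∈ Icc c d, ∀ x, ‖fld k t (clampW W M t x)‖ ≤ L := by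
    refine ⟨⟨(1 + R ^ 2) * (1 + k * R / c), by positivity⟩, fun t ht x => ?_⟩
    have ht0 : 0 < t := hc.trans_le ht.1
    have hx := abs_le.2 (hb t ht x)
    set y := clampW W M t x
    unfold fld
    rw [norm_mul, Real.norm_eq_abs, Real.norm_eq_abs]
    have h1 : |1 - y ^ 2| ≤ 1 + R ^ 2 := by
      refine (abs_sub _ _).trans ?_
      rw [abs_one, abs_pow]; gcongr
    have h2 : |1 - k * y / t| ≤ 1 + k * R / c := by
      refine (abs_sub _ _).trans ?_
      rw [abs_one, abs_div, abs_mul, abs_of_pos hk, abs_of_pos ht0]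
      gcongr; exact ht.1
    exact mul_le_mul h1 h2 (abs_nonneg _) (by positivity)
  obtain ⟨L, hL⟩ := hbd
  have hPL : IsPicardLindelof (fun s x => fld k s (clampW W M s x)) (tmin := c) (tmax := d)
      ⟨s0, Ioo_subset_Icc_self hs⟩ x0 (L * ⟨d - c, by linarith [hs.1, hs.2]⟩) 0 L K :=
    { lipschitzOnWith := fun t ht => (hK t ht).lipschitzOnWith
      continuousOn := fun x _ => hcont x
      norm_le := fun t ht x _ => hL t ht x
      mul_max_le := by
        push_cast
        rw [sub_zero]
        apply mul_le_mul_of_nonneg_left _ L.2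
        apply max_le
        · show d - s0 ≤ d - c
          linarith [hs.1]
        · show s0 - c ≤ d - c
          linarith [hs.2] }
  obtain ⟨V, hV0, hV⟩ := hPL.exists_eq_forall_mem_Icc_hasDerivWithinAt₀
  exact ⟨V, hV0, fun s hs' => (hV s (Ioo_subset_Icc_self hs')).hasDerivAt (Icc_mem_nhds hs'.1 hs'.2)⟩

lemma trunc2 (k : ℝ) (hk : 0 < k) (W : ℝ → ℝ)
    (hWode : ∀ s : ℝ, 0 < s → HasDerivAt W (fld k s (W s)) s)
    (hWabove : ∀ s : ℝ, 0 < s → 1 < W s)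
    (hWs : ∀ s, 0 < s → s < k * W s)
    (M c d s0 x0 : ℝ) (hc : 0 < c) (hs : s0 ∈ Ioo c d) (hx0 : W s0 < x0) :
    ∃ V : ℝ → ℝ, V s0 = x0 ∧
      (∀ s ∈ Ioo c d, HasDerivAt V (fld k s (clampW W M s (V s))) s) ∧
      (∀ s ∈ Ioo c d, V s ≤ M → HasDerivAt V (fld k s (V s)) s) ∧
      StrictMonoOn V (Ioo c d) := by
  have hWc : ContinuousOn W (Ioi 0) := HasDerivAt.continuousOn fun s hs => hWode s hs
  obtain ⟨V, hV0, hV⟩ := trunc_exists k hk W hWc M c d s0 x0 hc hs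
  have hLL : LocLip (fun s x => fld k s (clampW W M s x)) := by
    intro c d R hc _
    obtain ⟨K, hK⟩ := clamp_locLip k hk W hWc M c d hc
    exact ⟨K, fun t ht => (hK t ht).lipschitzOnWith⟩
  have hVW : ∀ s ∈ Ioo c d, W s < V s := by
    refine compare _ hLL c d s0 hc.le hs W V ?_ hV (by rw [hV0]; exact hx0)
    intro s hs
    have : clampW W M s (W s) = W s := max_eq_left (min_le_left _ _)
    simp only [this]
    exact hWode s (hc.trans hs.1)
  refine ⟨V, hV0, hV, ?_, ?_⟩
  · intro s hs hM
    have : clampW W M s (V s) = V s := by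
      unfold clampW; rw [min_eq_left hM, max_eq_right (hVW s hs).le]
    have h := hV s hs
    rwa [this] at h
  · apply strictMonoOn_of_deriv_pos (convex_Ioo _ _) (HasDerivAt.continuousOn hV)
    intro s hs
    have hs := interior_subset hs
    have hsp : 0 < s := hc.trans hs.1
    rw [(hV s hs).deriv]
    have h1 : W s ≤ clampW W M s (V s) := le_max_left _ _
    apply fld_pos k s _ hsp ((hWabove s hsp).trans_le h1)
    exact (hWs s hsp).trans_le (by gcongr)

lemma main_aux (k : ℝ) (hk : 0 < k) (W : ℝ → ℝ)
    (hWode : ∀ s : ℝ, 0 < s → HasDerivAt W (fld k s (W s)) s)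
    (hWabove : ∀ s : ℝ, 0 < s → 1 < W s)
    (hWnocrit : ∀ s : ℝ, 0 < s → deriv W s ≠ 0)
    (a b s₀ : ℝ) (ha : 0 ≤ a) (has₀ : a < s₀) (hs₀b : s₀ < b) (w : ℝ → ℝ)
    (hode : ∀ s ∈ Set.Ioo a b, HasDerivAt w (fld k s (w s)) s)
    (habove : W s₀ < w s₀) :
    ∃ s₁ : ℝ, s₀ < s₁ ∧
      Set.Ioo a b ⊆ Set.Ioo 0 s₁ ∧
      ∃ v : ℝ → ℝ,
        Set.EqOn v w (Set.Ioo a b) ∧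
        (∀ s ∈ Set.Ioo 0 s₁, HasDerivAt v (fld k s (v s)) s) ∧
        (∀ s ∈ Set.Ioo 0 s₁, W s < v s) ∧
        (∀ s ∈ Set.Ioo 0 s₁, deriv v s ≠ 0) ∧
        Tendsto v (nhdsWithin s₁ (Set.Iio s₁)) atTop := by
  have hWs := W_super k hk W hWode hWabove hWnocrit
  have hLL := fld_locLip k hk
  have hs0 : 0 < s₀ := ha.trans_lt has₀
  let P : ℝ → ℝ → (ℝ → ℝ) → Prop := fun c d v => 0 ≤ c ∧ s₀ ∈ Ioo c d ∧ v s₀ = w s₀ ∧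
    ∀ s ∈ Ioo c d, HasDerivAt v (fld k s (v s)) s
  let I : Set ℝ := {t | ∃ c d v, P c d v ∧ t ∈ Ioo c d}
  have hPw : P a b w := ⟨ha, ⟨has₀, hs₀b⟩, rfl, hode⟩
  have hPI : ∀ c d v, P c d v → Ioo c d ⊆ I := fun c d v h t ht => ⟨c, d, v, h, ht⟩
  have hPW : ∀ c d v, P c d v → ∀ s ∈ Ioo c d, W s < v s := fun c d v h =>
    compare _ hLL c d s₀ h.1 h.2.1 W v (fun s hs => hWode s (h.1.trans_lt hs.1)) h.2.2.2
      (by rw [h.2.2.1]; exact habove)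
  -- upper bound
  have hbdd : BddAbove I := by
    refine ⟨max s₀ (Real.exp ((((w s₀ - W s₀) ^ 2)⁻¹ + 2 * k * Real.log s₀) / (2 * k))), ?_⟩
    rintro t ⟨c, d, v, h, ht⟩
    rcases le_total t s₀ with h1 | h1
    · exact le_max_of_le_left h1
    · apply le_max_of_le_right
      rw [← h.2.2.1]
      have hsub : ∀ s ∈ Ico s₀ d, s ∈ Ioo c d := fun s hs => ⟨h.2.1.1.trans_le hs.1, hs.2⟩
      exact bound k hk W v d s₀ hs0 hWode hWabove hWs (fun s hs => h.2.2.2 s (hsub s hs))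
        (fun s hs => hPW c d v h s (hsub s hs)) t ⟨h1, ht.2⟩
  -- backward
  have hback : ∀ t, 0 < t → t < s₀ → t ∈ I := by
    intro t ht hts
    obtain ⟨V, hV0, -, hV, hmono⟩ := trunc2 k hk W hWode hWabove hWs (w s₀ + 1) (t / 2) (s₀ + 1) s₀
      (w s₀) (by linarith) ⟨by linarith, by linarith⟩ habove
    have hmem : s₀ ∈ Ioo (t / 2) (s₀ + 1) := ⟨by linarith, by linarith⟩
    have hca : ContinuousAt V s₀ := (hV s₀ hmem (by rw [hV0]; linarith)).continuousAt
    have hev := hca.eventually (gt_mem_nhds (by rw [hV0]; linarith : V s₀ < w s₀ + 1))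
    obtain ⟨ε, hε, hball⟩ := Metric.eventually_nhds_iff.1 hev
    refine ⟨t / 2, s₀ + min (ε / 2) 1, V, ⟨by linarith, ⟨hmem.1, ?_⟩, hV0, ?_⟩, ?_⟩
    · have : 0 < min (ε / 2) 1 := lt_min (by linarith) one_pos
      linarith
    · intro s hs
      have h1 := min_le_left (ε / 2) 1
      have h2 := min_le_right (ε / 2) 1
      have hs' : s ∈ Ioo (t / 2) (s₀ + 1) := ⟨hs.1, by linarith [hs.2]⟩
      apply hV s hs'
      rcases le_total s s₀ with h | h
      · have := hmono.monotoneOn hs' hmem h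
        linarith
      · apply (hball _).le
        rw [Real.dist_eq, abs_of_nonneg (by linarith)]
        linarith [hs.2]
    · have : 0 < min (ε / 2) 1 := lt_min (by linarith) one_pos
      exact ⟨by linarith, by linarith⟩
  -- glued solution
  have hex : ∀ t, ∃ x, ∀ c d v, P c d v → t ∈ Ioo c d → v t = x := by
    intro t
    by_cases ht : t ∈ I
    · obtain ⟨c, d, v, h, ht⟩ := ht
      refine ⟨v t, fun c' d' v' h' ht' => ?_⟩
      refine uniq _ hLL (max c c') (min d d') s₀ (le_max_of_le_left h.1)
        ⟨max_lt h.2.1.1 h'.2.1.1, lt_min h.2.1.2 h'.2.1.2⟩ v' v ?_ ?_ ?_ 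
        ⟨max_lt ht.1 ht'.1, lt_min ht.2 ht'.2⟩
      · exact fun s hs => h'.2.2.2 s ⟨(le_max_right _ _).trans_lt hs.1, hs.2.trans_le (min_le_right _ _)⟩
      · exact fun s hs => h.2.2.2 s ⟨(le_max_left _ _).trans_lt hs.1, hs.2.trans_le (min_le_left _ _)⟩
      · rw [h.2.2.1, h'.2.2.1]
    · exact ⟨0, fun c d v h h' => absurd ⟨c, d, v, h, h'⟩ ht⟩
  choose v hv using hex
  have hveq : ∀ c d u, P c d u → EqOn v u (Ioo c d) := fun c d u h t ht => (hv t c d u h ht).symm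
  have hvode : ∀ t ∈ I, HasDerivAt v (fld k t (v t)) t := by
    rintro t ⟨c, d, u, h, ht⟩
    have he := hveq c d u h
    rw [he ht]
    exact (h.2.2.2 t ht).congr_of_eventuallyEq (he.eventuallyEq_of_mem (Ioo_mem_nhds ht.1 ht.2))
  have hvW : ∀ t ∈ I, W t < v t := by
    rintro t ⟨c, d, u, h, ht⟩
    rw [hveq c d u h ht]
    exact hPW c d u h t ht
  have habI := hPI a b w hPw
  have hlt : ∀ t ∈ I, t < sSup I := by
    rintro t ⟨c, d, u, h, ht⟩
    obtain ⟨t', h1, h2⟩ := exists_between ht.2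
    exact h1.trans_le (le_csSup hbdd (hPI c d u h ⟨ht.1.trans h1, h2⟩))
  have hs0I : s₀ ∈ I := habI ⟨has₀, hs₀b⟩
  have hsub : Ioo 0 (sSup I) ⊆ I := by
    intro t ht
    rcases lt_or_ge t s₀ with h | h
    · exact hback t ht.1 h
    · obtain ⟨t', ⟨c, d, u, hP, ht'⟩, htt⟩ := exists_lt_of_lt_csSup ⟨s₀, hs0I⟩ ht.2
      exact ⟨c, d, u, hP, hP.2.1.1.trans_le h, htt.trans ht'.2⟩
  have hpos : ∀ s ∈ Ioo 0 (sSup I), 0 < fld k s (v s) := by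
    intro s hs
    have h := hvW s (hsub hs)
    exact fld_pos k s _ hs.1 ((hWabove s hs.1).trans h) ((hWs s hs.1).trans (by gcongr))
  have hmonov : StrictMonoOn v (Ioo 0 (sSup I)) := by
    apply strictMonoOn_of_deriv_pos (convex_Ioo _ _)
      (HasDerivAt.continuousOn fun s hs => hvode s (hsub hs))
    intro s hs
    have hs := interior_subset hs
    rw [(hvode s (hsub hs)).deriv]
    exact hpos s hs
  have hs1 := hlt s₀ hs0I
  have hv0 : v s₀ = w s₀ := hveq a b w hPw ⟨has₀, hs₀b⟩
  refine ⟨sSup I, hs1, fun t ht => ⟨ha.trans_lt ht.1, hlt t (habI ht)⟩, v,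
    hveq a b w hPw, fun s hs => hvode s (hsub hs), fun s hs => hvW s (hsub hs), ?_, ?_⟩
  · intro s hs
    rw [(hvode s (hsub hs)).deriv]
    exact (hpos s hs).ne'
  · -- blow-up
    rw [tendsto_atTop]
    intro M
    by_cases hM : ∃ t ∈ Ioo 0 (sSup I), M ≤ v t
    · obtain ⟨t, ht, hMt⟩ := hM
      filter_upwards [Ioo_mem_nhdsLT ht.2] with s hs
      exact hMt.trans (hmonov.monotoneOn ht ⟨ht.1.trans hs.1, hs.2⟩ hs.1.le)
    · exfalso
      push Not at hM
      set s₁ := sSup I with hs₁def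
      have hmem : s₀ ∈ Ioo (s₀ / 2) (s₁ + 1) := ⟨by linarith, by linarith⟩
      have hmem1 : s₁ ∈ Ioo (s₀ / 2) (s₁ + 1) := ⟨by linarith, by linarith⟩
      obtain ⟨V, hV0, hVt, hV, hmono⟩ := trunc2 k hk W hWode hWabove hWs (M + 1) (s₀ / 2) (s₁ + 1) s₀
        (w s₀) (by linarith) hmem habove
      have hWc : ContinuousOn W (Ioi 0) := HasDerivAt.continuousOn fun s hs => hWode s hs
      have hLL' : LocLip (fun s x => fld k s (clampW W (M + 1) s x)) := by
        intro c d R hc _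
        obtain ⟨K, hK⟩ := clamp_locLip k hk W hWc (M + 1) c d hc
        exact ⟨K, fun t ht => (hK t ht).lipschitzOnWith⟩
      have heq : EqOn V v (Ioo (s₀ / 2) s₁) := by
        refine uniq _ hLL' (s₀ / 2) s₁ s₀ (by linarith) ⟨by linarith, hs1⟩ V v
          (fun s hs => hVt s ⟨hs.1, by linarith [hs.2]⟩) ?_ (by rw [hV0, hv0])
        intro s hs
        have hs' : s ∈ Ioo 0 s₁ := ⟨by linarith [hs.1], hs.2⟩
        have : clampW W (M + 1) s (v s) = v s := by
          unfold clampW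
          rw [min_eq_left (by linarith [hM s hs']), max_eq_right (hvW s (hsub hs')).le]
        simp only [this]
        exact hvode s (hsub hs')
      have hca : ContinuousAt V s₁ := (hVt s₁ hmem1).continuousAt
      have hle : V s₁ ≤ M := by
        refine le_of_tendsto (hca.tendsto.mono_left (nhdsWithin_le_nhds (s := Iio s₁))) ?_
        filter_upwards [Ioo_mem_nhdsLT hs1] with s hs
        rw [heq ⟨by linarith [hs.1], hs.2⟩]
        exact (hM s ⟨by linarith [hs.1], hs.2⟩).le
      have hev := hca.eventually (gt_mem_nhds (by linarith : V s₁ < M + 1))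
      obtain ⟨ε, hε, hball⟩ := Metric.eventually_nhds_iff.1 hev
      have h0 : 0 < min (ε / 2) 1 := lt_min (by linarith) one_pos
      have h1 := min_le_left (ε / 2) 1
      have h2 := min_le_right (ε / 2) 1
      have hP : P (s₀ / 2) (s₁ + min (ε / 2) 1) V := by
        refine ⟨by linarith, ⟨hmem.1, by linarith⟩, hV0, ?_⟩
        intro s hs
        have hs' : s ∈ Ioo (s₀ / 2) (s₁ + 1) := ⟨hs.1, by linarith [hs.2]⟩
        apply hV s hs'
        rcases le_total s s₁ with h | h
        · have := hmono.monotoneOn hs' hmem1 h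
          linarith
        · apply (hball _).le
          rw [Real.dist_eq, abs_of_nonneg (by linarith)]
          linarith [hs.2]
      exact lt_irrefl _ (hlt s₁ (hPI _ _ _ hP ⟨hmem1.1, by linarith⟩))



/-- **Case VII, classification.** If `W = 𝐰` is the unique global solution
of `(★)` above `1` with no critical points, then any solution `w` with `w(s₀) > W(s₀)` at
some point extends maximally to a solution `v` defined exactly on an interval `(0, s₁)`
with `s₀ < s₁ < ∞`, lying above `W`, with no critical points, blowing up to `+∞` at `s₁`. -/
theorem solution_above_asymptotic_solution_blows_up (n : ℕ) (hn : 2 ≤ n) (W : ℝ → ℝ)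
    -- W is the distinguished solution 𝐰
    (hWode : ∀ s : ℝ, 0 < s →
      HasDerivAt W ((1 - W s ^ 2) * (1 - (n - 1 : ℝ) * W s / s)) s)
    (hWabove : ∀ s : ℝ, 0 < s → 1 < W s)
    (hWnocrit : ∀ s : ℝ, 0 < s → deriv W s ≠ 0)
    -- w is a solution on an interval `(a,b) ⊆ (0,∞)` around `s₀`
    (a b s₀ : ℝ) (ha : 0 ≤ a) (has₀ : a < s₀) (hs₀b : s₀ < b) (w : ℝ → ℝ)
    (hode : ∀ s ∈ Set.Ioo a b,
      HasDerivAt w ((1 - w s ^ 2) * (1 - (n - 1 : ℝ) * w s / s)) s)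
    (habove : W s₀ < w s₀) :
    ∃ s₁ : ℝ, s₀ < s₁ ∧
      Set.Ioo a b ⊆ Set.Ioo 0 s₁ ∧
      ∃ v : ℝ → ℝ,
        Set.EqOn v w (Set.Ioo a b) ∧
        (∀ s ∈ Set.Ioo 0 s₁,
          HasDerivAt v ((1 - v s ^ 2) * (1 - (n - 1 : ℝ) * v s / s)) s) ∧
        (∀ s ∈ Set.Ioo 0 s₁, W s < v s) ∧
        (∀ s ∈ Set.Ioo 0 s₁, deriv v s ≠ 0) ∧
        Tendsto v (nhdsWithin s₁ (Set.Iio s₁)) atTop := by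

  have hk : (0 : ℝ) < (n : ℝ) - 1 := by
    have : (2 : ℝ) ≤ n := by exact_mod_cast hn
    linarith
  exact main_aux ((n : ℝ) - 1) hk W hWode hWabove hWnocrit a b s₀ ha has₀ hs₀b w hode habove
end

section
/- Let n ≥ 2 be a natural number. For every s₁ > 0 there exists a solution w : (0, s₁) → ℝ of (★) with w(s) > 1 for every s ∈ (0, s₁) and w(s) → +∞ as s → s₁⁻. -/
open Set Filter

lemma aux_E_lip (s₁ x y : ℝ) (hs₁ : 0 < s₁) :
    |Real.exp (min x (Real.log s₁)) - Real.exp (min y (Real.log s₁))| ≤ s₁ * |x - y| := by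
  have key : ∀ a b : ℝ, b ≤ a → a ≤ Real.log s₁ → Real.exp a - Real.exp b ≤ s₁ * (a - b) := by
    intro a b hab ha
    have h1 : Real.exp a ≤ s₁ := by
      rw [← Real.exp_log hs₁]; exact Real.exp_le_exp.2 ha
    have h2 := Real.add_one_le_exp (b - a)
    have h3 : Real.exp b = Real.exp a * Real.exp (b - a) := by
      rw [← Real.exp_add]; ring_nf
    have h4 := Real.exp_pos a
    rw [h3]
    nlinarith
  have hm : |min x (Real.log s₁) - min y (Real.log s₁)| ≤ |x - y| := by
    have := abs_min_sub_min_le_max x (Real.log s₁) y (Real.log s₁)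
    simpa using this
  refine le_trans ?_ (mul_le_mul_of_nonneg_left hm hs₁.le)
  rcases le_total (min x (Real.log s₁)) (min y (Real.log s₁)) with h | h
  · rw [abs_sub_comm, abs_sub_comm (min x _), abs_of_nonneg (sub_nonneg.2 (Real.exp_le_exp.2 h)),
      abs_of_nonneg (sub_nonneg.2 h)]
    exact key _ _ h (min_le_right _ _)
  · rw [abs_of_nonneg (sub_nonneg.2 (Real.exp_le_exp.2 h)),
      abs_of_nonneg (sub_nonneg.2 h)]
    exact key _ _ h (min_le_right _ _)

lemma aux_ode (m s₁ δ : ℝ) (hs₁ : 0 < s₁) (hδ : 0 < δ) (V : ℝ → ℝ) (hV : Continuous V)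
    (h0 : ∀ p, 0 ≤ V p) (h1 : ∀ p ∈ Icc (0:ℝ) 1, V p ≤ 1) :
    ∃ ρ : ℝ → ℝ, ρ 1 = Real.log s₁ ∧ ∀ p ∈ Icc (0:ℝ) 1, HasDerivWithinAt ρ
      (V p * Real.exp (min (ρ p) (Real.log s₁)) /
        max (m - V p * p * Real.exp (min (ρ p) (Real.log s₁))) δ) (Icc 0 1) p := by
  have hE : ∀ x, Real.exp (min x (Real.log s₁)) ≤ s₁ := by
    intro x
    calc _ ≤ Real.exp (Real.log s₁) := Real.exp_le_exp.2 (min_le_right _ _)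
      _ = s₁ := Real.exp_log hs₁
  have hE0 : ∀ x, 0 < Real.exp (min x (Real.log s₁)) := fun x => Real.exp_pos _
  let f : ℝ → ℝ → ℝ := fun p x => V p * Real.exp (min x (Real.log s₁)) /
        max (m - V p * p * Real.exp (min x (Real.log s₁))) δ
  have hL : 0 ≤ s₁ / δ := by positivity
  have hK : 0 ≤ (s₁ / δ ^ 2 + 1 / δ) * s₁ := by positivity
  have hPL : IsPicardLindelof f (tmin := 0) (tmax := 1) ⟨1, by simp⟩ (Real.log s₁)
      ⟨s₁ / δ, hL⟩ 0 ⟨s₁ / δ, hL⟩ ⟨(s₁ / δ ^ 2 + 1 / δ) * s₁, hK⟩ := by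
    refine ⟨?_, ?_, ?_, ?_⟩
    · intro p hp
      apply LipschitzOnWith.of_dist_le_mul
      intro x _ y _
      rw [Real.dist_eq, Real.dist_eq]
      change |f p x - f p y| ≤ (s₁ / δ ^ 2 + 1 / δ) * s₁ * |x - y|
      have hl := aux_E_lip s₁ x y hs₁
      simp only [f]
      have a1 := hE x
      have a3 := hE0 x
      set A := Real.exp (min x (Real.log s₁))
      set B := Real.exp (min y (Real.log s₁))
      have hVp0 := h0 p
      have hVp1 := h1 p hp
      have hMM : |max (m - V p * p * B) δ - max (m - V p * p * A) δ| ≤ |A - B| := by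
        have := abs_max_sub_max_le_max (m - V p * p * B) δ (m - V p * p * A) δ
        refine this.trans ?_
        simp only [sub_self, abs_zero]
        refine max_le ?_ (abs_nonneg _)
        have e : m - V p * p * B - (m - V p * p * A) = (V p * p) * (A - B) := by ring
        rw [e, abs_mul, abs_of_nonneg (mul_nonneg hVp0 hp.1)]
        have : V p * p ≤ 1 := mul_le_one₀ hVp1 hp.1 hp.2
        nlinarith [abs_nonneg (A - B)]
      have hM1 : δ ≤ max (m - V p * p * A) δ := le_max_right _ _
      have hM2 : δ ≤ max (m - V p * p * B) δ := le_max_right _ _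
      set M := max (m - V p * p * A) δ
      set N := max (m - V p * p * B) δ
      have hM : 0 < M := lt_of_lt_of_le hδ hM1
      have hN : 0 < N := lt_of_lt_of_le hδ hM2
      have e : V p * A / M - V p * B / N = V p * (A / (M * N) * (N - M) + 1 / N * (A - B)) := by
        field_simp; ring
      rw [e, abs_mul, abs_of_nonneg hVp0]
      have b1 : A / (M * N) ≤ s₁ / δ ^ 2 := by
        rw [pow_two]; gcongr
      have b2 : 1 / N ≤ 1 / δ := by gcongr
      have b0 : 0 ≤ A / (M * N) := by positivity
      calc V p * |A / (M * N) * (N - M) + 1 / N * (A - B)|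
          ≤ 1 * |A / (M * N) * (N - M) + 1 / N * (A - B)| := by gcongr
        _ ≤ |A / (M * N) * (N - M)| + |1 / N * (A - B)| := by rw [one_mul]; exact abs_add_le _ _
        _ = A / (M * N) * |N - M| + 1 / N * |A - B| := by
            rw [abs_mul, abs_mul, abs_of_nonneg b0, abs_of_nonneg (by positivity : 0 ≤ 1 / N)]
        _ ≤ s₁ / δ ^ 2 * |A - B| + 1 / δ * |A - B| := by gcongr
        _ = (s₁ / δ ^ 2 + 1 / δ) * |A - B| := by ring
        _ ≤ (s₁ / δ ^ 2 + 1 / δ) * (s₁ * |x - y|) := by gcongr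
        _ = _ := by ring
    · intro x _
      apply Continuous.continuousOn
      simp only [f]
      refine Continuous.div (by fun_prop) (by fun_prop) ?_
      intro p
      exact (lt_of_lt_of_le hδ (le_max_right _ _)).ne'
    · intro p hp x _
      change |f p x| ≤ s₁ / δ
      simp only [f]
      have hM1 : δ ≤ max (m - V p * p * Real.exp (min x (Real.log s₁))) δ := le_max_right _ _
      have := hE x
      have := hE0 x
      have := h0 p
      have := h1 p hp
      have hM := lt_of_lt_of_le hδ hM1
      rw [abs_of_nonneg (by positivity)]
      gcongr
      nlinarith
    · change s₁ / δ * max ((1:ℝ) - 1) (1 - 0) ≤ s₁ / δ - 0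
      simp
  obtain ⟨ρ, h, h'⟩ := hPL.exists_eq_forall_mem_Icc_hasDerivWithinAt₀
  exact ⟨ρ, h, h'⟩

lemma aux_V_deriv (k : ℕ) (hk : 1 ≤ k) (p : ℝ) (hp : p ∈ Ioo (0:ℝ) 1) :
    0 < 1 - p ^ (2 * k) ∧ HasDerivAt (fun p : ℝ => √(1 - p ^ (2 * k)))
      (-(k * p ^ (2 * k) / p) / √(1 - p ^ (2 * k))) p := by
  have h1 : 0 < 1 - p ^ (2 * k) := by
    have : p ^ (2 * k) < 1 := pow_lt_one₀ hp.1.le hp.2 (by omega)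
    linarith
  refine ⟨h1, ?_⟩
  have h := ((hasDerivAt_pow (2 * k) p).const_sub 1).sqrt h1.ne'
  convert h using 1
  have hs := Real.sqrt_pos.2 h1
  have hp0 := hp.1
  have e : p ^ (2 * k) = p ^ (2 * k - 1) * p := by
    rw [← pow_succ]; congr 1; omega
  have e2 : p ^ (2 * k) / p = p ^ (2 * k - 1) := by rw [e]; field_simp
  rw [mul_div_assoc, e2]
  push_cast
  field_simp

lemma aux_S (k : ℕ) (hk : 1 ≤ k) (s₁ : ℝ) (hs₁ : 0 < s₁) :
    ∃ S : ℝ → ℝ, ContinuousOn S (Icc 0 1) ∧ S 0 = 0 ∧ S 1 = s₁ ∧ ∀ p ∈ Ioo (0:ℝ) 1,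
      0 < S p ∧ √(1 - p ^ (2 * k)) * S p < k ∧
      HasDerivAt S (k * S p / (p * (k - √(1 - p ^ (2 * k)) * S p))) p := by
  have hm : (0:ℝ) < k := by exact_mod_cast hk
  set m : ℝ := (k : ℝ) with hmdef
  let V : ℝ → ℝ := fun p => √(1 - p ^ (2 * k))
  have hVc : Continuous V := by fun_prop
  have hV0 : ∀ p, 0 ≤ V p := fun p => Real.sqrt_nonneg _
  have hV1 : ∀ p ∈ Icc (0:ℝ) 1, V p ≤ 1 := by
    intro p hp
    simp only [V]
    rw [Real.sqrt_le_iff]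
    refine ⟨zero_le_one, ?_⟩
    have := pow_nonneg hp.1 (2 * k)
    linarith
  obtain ⟨δ, hδ, hδ1, hδ2⟩ : ∃ δ : ℝ, 0 < δ ∧ δ ≤ m / 2 ∧ δ ≤ m ^ 2 / (16 * s₁ ^ 2) :=
    ⟨min (m / 2) (m ^ 2 / (16 * s₁ ^ 2)), by positivity, min_le_left _ _, min_le_right _ _⟩
  obtain ⟨ρ, hρ1, hρ⟩ := aux_ode m s₁ δ hs₁ hδ V hVc hV0 hV1
  have hρc : ContinuousOn ρ (Icc 0 1) := fun p hp => (hρ p hp).continuousWithinAt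
  have hρ' : ∀ p ∈ Ioo (0:ℝ) 1, HasDerivAt ρ (V p * Real.exp (min (ρ p) (Real.log s₁)) /
        max (m - V p * p * Real.exp (min (ρ p) (Real.log s₁))) δ) p := fun p hp =>
    (hρ p (Ioo_subset_Icc_self hp)).hasDerivAt (Icc_mem_nhds hp.1 hp.2)
  have hmono : MonotoneOn ρ (Icc 0 1) := by
    apply monotoneOn_of_deriv_nonneg (convex_Icc _ _) hρc
    · rw [interior_Icc]
      intro p hp
      exact (hρ' p hp).differentiableAt.differentiableWithinAt
    · rw [interior_Icc]
      intro p hp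
      rw [(hρ' p hp).deriv]
      have := hV0 p
      have : 0 < max (m - V p * p * Real.exp (min (ρ p) (Real.log s₁))) δ :=
        lt_of_lt_of_le hδ (le_max_right _ _)
      positivity
  have hle : ∀ p ∈ Icc (0:ℝ) 1, ρ p ≤ Real.log s₁ := by
    intro p hp
    rw [← hρ1]
    exact hmono hp (by simp) hp.2
  let S : ℝ → ℝ := fun p => p * Real.exp (ρ p)
  have hSc : ContinuousOn S (Icc 0 1) := by
    simp only [S]; fun_prop
  have hSle : ∀ p ∈ Icc (0:ℝ) 1, S p ≤ s₁ := by
    intro p hp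
    have : Real.exp (ρ p) ≤ s₁ := by
      rw [← Real.exp_log hs₁]; exact Real.exp_le_exp.2 (hle p hp)
    simp only [S]
    nlinarith [Real.exp_pos (ρ p), hp.1, hp.2]
  have hS0 : S 0 = 0 := by simp [S]
  have hS1 : S 1 = s₁ := by simp [S, hρ1, Real.exp_log hs₁]
  have hSpos : ∀ p ∈ Ioo (0:ℝ) 1, 0 < S p := fun p hp => mul_pos hp.1 (Real.exp_pos _)
  have hSd : ∀ p ∈ Ioo (0:ℝ) 1, HasDerivAt S
      (S p / p * (1 + V p * S p / max (m - V p * S p) δ)) p := by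
    intro p hp
    have h := (hasDerivAt_id p).mul (hρ' p hp).exp
    have hp0 := hp.1
    refine HasDerivAt.congr_deriv (f := S) h ?_
    rw [min_eq_left (hle p (Ioo_subset_Icc_self hp))]
    have e : V p * p * Real.exp (ρ p) = V p * S p := by simp only [S]; ring
    rw [e]
    have : 0 < max (m - V p * S p) δ := lt_of_lt_of_le hδ (le_max_right _ _)
    generalize max (m - V p * S p) δ = M at *
    simp only [S, id]
    field_simp
  have hg : ∀ p ∈ Icc (0:ℝ) 1, V p * S p ≤ m - δ := by
    obtain ⟨q, hq, hqmax⟩ := isCompact_Icc.exists_isMaxOn (nonempty_Icc.2 (zero_le_one' ℝ))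
      (hVc.continuousOn.mul hSc : ContinuousOn (fun p => V p * S p) (Icc 0 1))
    intro p hp
    refine (hqmax hp).trans ?_
    change V q * S q ≤ m - δ
    by_contra! hlt
    have hVS : m / 2 ≤ V q * S q := by linarith
    have hVS0 : 0 < V q * S q := by linarith
    have hq' : q ∈ Ioo (0:ℝ) 1 := by
      refine ⟨lt_of_le_of_ne hq.1 ?_, lt_of_le_of_ne hq.2 ?_⟩
      · rintro rfl; rw [hS0] at hVS0; simp at hVS0
      · rintro rfl
        have : V 1 = 0 := by simp [V]
        rw [this] at hVS0; simp at hVS0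
    obtain ⟨hv1, hVd⟩ := aux_V_deriv k hk q hq'
    have hd := hVd.mul (hSd q hq')
    have hloc : IsLocalMax (fun p => V p * S p) q :=
      hqmax.isLocalMax (Icc_mem_nhds hq'.1 hq'.2)
    have hz := hloc.hasDerivAt_eq_zero hd
    have hVp : 0 < V q := Real.sqrt_pos.2 hv1
    change -(m * q ^ (2 * k) / q) / V q * S q +
      V q * (S q / q * (1 + V q * S q / max (m - V q * S q) δ)) = 0 at hz
    rw [max_eq_right (by linarith)] at hz
    have hSq := hSpos q hq'
    have hq0 := hq'.1
    have hz2 : V q ^ 2 * (δ + V q * S q) = δ * m * q ^ (2 * k) := by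
      have hz3 : S q * (-(m * q ^ (2 * k) * δ) + V q ^ 2 * (δ + V q * S q)) = 0 := by
        field_simp at hz
        linarith
      rcases mul_eq_zero.1 hz3 with h | h
      · exact absurd h hSq.ne'
      · linarith
    have hpow : q ^ (2 * k) ≤ 1 := by linarith
    have hVlow : m / 2 ≤ V q * s₁ :=
      hVS.trans (mul_le_mul_of_nonneg_left (hSle q hq) hVp.le)
    have hV2 : m ^ 2 / (4 * s₁ ^ 2) ≤ V q ^ 2 := by
      rw [div_le_iff₀ (by positivity)]
      nlinarith
    have h3 : 4 * δ ≤ V q ^ 2 := by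
      refine le_trans ?_ hV2
      have : m ^ 2 / (4 * s₁ ^ 2) = 4 * (m ^ 2 / (16 * s₁ ^ 2)) := by field_simp; norm_num
      linarith
    have h4 : 4 * δ * (m / 2) ≤ V q ^ 2 * (δ + V q * S q) := by
      apply mul_le_mul h3 (by linarith) (by positivity) (by positivity)
    have h5 : δ * m * q ^ (2 * k) ≤ δ * m * 1 := by gcongr
    nlinarith [mul_pos hδ hm]
  refine ⟨S, hSc, hS0, hS1, fun p hp => ?_⟩
  have hgp := hg p (Ioo_subset_Icc_self hp)
  refine ⟨hSpos p hp, ?_, ?_⟩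
  · change V p * S p < m; linarith
  · have := hSd p hp
    rw [max_eq_left (by linarith)] at this
    refine this.congr_deriv (Eq.symm ?_)
    change m * S p / (p * (m - V p * S p)) = _
    have h1 : 0 < m - V p * S p := by linarith
    have hp0 := hp.1
    generalize V p * S p = x at *
    have h2 : m - x ≠ 0 := h1.ne'
    field_simp
    ring

theorem exists_blow_up_solution (n : ℕ) (hn : 2 ≤ n) (s₁ : ℝ) (hs₁ : 0 < s₁) :
    ∃ w : ℝ → ℝ,
      (∀ s ∈ Set.Ioo 0 s₁,
        HasDerivAt w ((1 - w s ^ 2) * (1 - (n - 1 : ℝ) * w s / s)) s) ∧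
      (∀ s ∈ Set.Ioo 0 s₁, 1 < w s) ∧
      Tendsto w (nhdsWithin s₁ (Set.Iio s₁)) atTop := by
  obtain ⟨k, rfl⟩ : ∃ k, n = k + 1 := ⟨n - 1, by omega⟩
  have hk : 1 ≤ k := by omega
  have hkr : (0:ℝ) < k := by exact_mod_cast hk
  obtain ⟨S, hSc, hS0, hS1, hS⟩ := aux_S k hk s₁ hs₁
  have hSpos' : ∀ p ∈ Ioo (0:ℝ) 1, 0 < k * S p / (p * (k - √(1 - p ^ (2 * k)) * S p)) := by
    intro p hp
    obtain ⟨h1, h2, h3⟩ := hS p hp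
    have := hp.1
    have : 0 < (k:ℝ) - √(1 - p ^ (2 * k)) * S p := by linarith
    positivity
  have hSm : StrictMonoOn S (Icc 0 1) := by
    apply strictMonoOn_of_deriv_pos (convex_Icc _ _) hSc
    rw [interior_Icc]
    intro p hp
    rw [(hS p hp).2.2.deriv]
    exact hSpos' p hp
  have hsurj : SurjOn S (Icc 0 1) (Icc 0 s₁) := by
    have := intermediate_value_Icc (zero_le_one' ℝ) hSc
    rwa [hS0, hS1] at this
  have hsurj' : ∀ s, s ∈ Icc 0 s₁ → ∃ p, p ∈ Icc (0:ℝ) 1 ∧ S p = s := fun s hs => hsurj hs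
  choose! P hPm hPS using hsurj'
  have h0m : (0:ℝ) ∈ Icc (0:ℝ) 1 := by simp
  have h1m : (1:ℝ) ∈ Icc (0:ℝ) 1 := by simp
  have hPmono : StrictMonoOn P (Icc 0 s₁) := by
    intro a ha b hb hab
    rw [← hSm.lt_iff_lt (hPm a ha) (hPm b hb), hPS a ha, hPS b hb]
    exact hab
  have hPinv : ∀ p ∈ Icc (0:ℝ) 1, S p ∈ Icc 0 s₁ ∧ P (S p) = p := by
    intro p hp
    have hm : S p ∈ Icc 0 s₁ := by
      constructor
      · rw [← hS0]; exact hSm.monotoneOn h0m hp hp.1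
      · rw [← hS1]; exact hSm.monotoneOn hp h1m hp.2
    exact ⟨hm, hSm.injOn (hPm _ hm) hp (hPS _ hm)⟩
  have himg : P '' Icc 0 s₁ = Icc 0 1 := by
    apply Subset.antisymm
    · rintro _ ⟨s, hs, rfl⟩; exact hPm _ hs
    · intro p hp; exact ⟨S p, (hPinv p hp).1, (hPinv p hp).2⟩
  have hP0 : P 0 = 0 := by rw [← hS0]; rw [(hPinv 0 h0m).2]; exact hS0.symm
  have hP1 : P s₁ = 1 := by rw [← hS1]; exact (hPinv 1 h1m).2
  have hPI : ∀ s ∈ Ioo 0 s₁, P s ∈ Ioo (0:ℝ) 1 := by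
    intro s hs
    constructor
    · rw [← hP0]; exact hPmono (by simp [hs₁.le]) (Ioo_subset_Icc_self hs) hs.1
    · rw [← hP1]; exact hPmono (Ioo_subset_Icc_self hs) (by simp [hs₁.le]) hs.2
  have hPd : ∀ s ∈ Ioo 0 s₁,
      HasDerivAt P (k * s / (P s * (k - √(1 - P s ^ (2 * k)) * s)))⁻¹ s := by
    intro s hs
    have hc : ContinuousAt P s := by
      apply hPmono.continuousAt_of_image_mem_nhds (Icc_mem_nhds hs.1 hs.2)
      rw [himg]
      exact Icc_mem_nhds (hPI s hs).1 (hPI s hs).2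
    have h := HasDerivAt.of_local_left_inverse hc (hS _ (hPI s hs)).2.2 (hSpos' _ (hPI s hs)).ne' (by
      filter_upwards [Icc_mem_nhds hs.1 hs.2] with y hy using hPS _ hy)
    rwa [hPS _ (Ioo_subset_Icc_self hs)] at h
  refine ⟨fun s => (√(1 - P s ^ (2 * k)))⁻¹, ?_, ?_, ?_⟩
  · intro s hs
    obtain ⟨hv, hVd⟩ := aux_V_deriv k hk (P s) (hPI s hs)
    have hVp := Real.sqrt_pos.2 hv
    have h := (hVd.comp s (hPd s hs)).inv hVp.ne'
    refine HasDerivAt.congr_deriv (f := fun s => (√(1 - P s ^ (2 * k)))⁻¹) h (Eq.symm ?_)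
    have hs0 := hs.1
    have hP0 := (hPI s hs).1
    have hlt := (hS _ (hPI s hs)).2.1
    rw [hPS _ (Ioo_subset_Icc_self hs)] at hlt
    have hsq : P s ^ (2 * k) = 1 - √(1 - P s ^ (2 * k)) ^ 2 := by
      rw [Real.sq_sqrt hv.le]; ring
    simp only [Function.comp]
    generalize √(1 - P s ^ (2 * k)) = v at *
    rw [hsq]
    have : (k:ℝ) - v * s ≠ 0 := by linarith
    push_cast
    field_simp
    ring
  · intro s hs
    obtain ⟨hv, hVd⟩ := aux_V_deriv k hk (P s) (hPI s hs)
    have hVp := Real.sqrt_pos.2 hv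
    apply (one_lt_inv₀ hVp).2
    rw [Real.sqrt_lt' one_pos]
    have := pow_pos (hPI s hs).1 (2 * k)
    linarith
  · apply Tendsto.inv_tendsto_nhdsGT_zero
    rw [tendsto_nhdsWithin_iff]
    constructor
    · have hc : ContinuousWithinAt P (Iic s₁) s₁ := by
        apply hPmono.continuousWithinAt_left_of_image_mem_nhdsWithin
          (Icc_mem_nhdsLE hs₁)
        rw [himg, hP1]
        exact Icc_mem_nhdsLE one_pos
      have hc2 : ContinuousWithinAt (fun s => √(1 - P s ^ (2 * k))) (Iio s₁) s₁ := by
        have := hc.mono Iio_subset_Iic_self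
        fun_prop
      have := hc2.tendsto
      simpa [hP1] using this
    · filter_upwards [Ioo_mem_nhdsLT hs₁] with s hs
      exact Real.sqrt_pos.2 (aux_V_deriv k hk (P s) (hPI s hs)).1
end

section
/- Let ε', ε̃ ∈ {−1, 1}, let h : ℝ → ℝ, let J be an open interval, and let α : J → ℝ be twice differentiable with α''(y) = (ε' + ε̃·α'(y)²)·(h(α(y)) − α'(y)) and α'(y) ≠ 0 for every y ∈ J. Let f be the inverse of α, i.e. f : α(J) → ℝ is twice differentiable with f(α(y)) = y for all y ∈ J. Then f''(s) = (ε̃ + ε'·f'(s)²)·(1 − f'(s)·h(s)) for every s ∈ α(J). -/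
open Set Filter

/-- Inversion of the wing-like ODE: if `α` solves
`α'' = (ε' + ε̃ α'²)(h(α) - α')` with nonvanishing derivative on an open interval `J`,
then its inverse `f` solves the graphical soliton ODE
`f'' = (ε̃ + ε' f'²)(1 - f' h)` on `α(J)`. -/
theorem inverse_of_winglike_solution_solves_soliton_ODE
    (ε' εt : ℝ) (hε' : ε' = -1 ∨ ε' = 1) (hεt : εt = -1 ∨ εt = 1)
    (h : ℝ → ℝ) (J : Set ℝ) (hJopen : IsOpen J) (hJinterval : J.OrdConnected)
    (α : ℝ → ℝ)
    (hα₁ : ∀ y ∈ J, DifferentiableAt ℝ α y)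
    (hα₂ : ∀ y ∈ J,
      HasDerivAt (deriv α) ((ε' + εt * (deriv α y) ^ 2) * (h (α y) - deriv α y)) y)
    (hα' : ∀ y ∈ J, deriv α y ≠ 0)
    (f : ℝ → ℝ)
    (hf₁ : ∀ s ∈ α '' J, DifferentiableAt ℝ f s)
    (hf₂ : ∀ s ∈ α '' J, DifferentiableAt ℝ (deriv f) s)
    (hinv : ∀ y ∈ J, f (α y) = y) :
    ∀ s ∈ α '' J,
      deriv (deriv f) s = (εt + ε' * (deriv f s) ^ 2) * (1 - deriv f s * h s) := by
  rintro s ⟨y, hy, rfl⟩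
  have key : ∀ z ∈ J, deriv f (α z) * deriv α z = 1 := by
    intro z hz
    have h1 : HasDerivAt (f ∘ α) (deriv f (α z) * deriv α z) z :=
      (hf₁ _ ⟨z, hz, rfl⟩).hasDerivAt.comp z (hα₁ z hz).hasDerivAt
    have h2 : (f ∘ α) =ᶠ[nhds z] id := by
      filter_upwards [hJopen.mem_nhds hz] with w hw using hinv w hw
    exact h1.unique ((hasDerivAt_id z).congr_of_eventuallyEq h2)
  have h1 := (((hf₂ _ ⟨y, hy, rfl⟩).hasDerivAt.comp y (hα₁ y hy).hasDerivAt).mul (hα₂ y hy))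
  have h2 : ((deriv f ∘ α) * deriv α) =ᶠ[nhds y] fun _ => (1 : ℝ) := by
    filter_upwards [hJopen.mem_nhds hy] with w hw using key w hw
  have h3 := h1.unique ((hasDerivAt_const y (1 : ℝ)).congr_of_eventuallyEq h2)
  have k := key y hy
  have ha := hα' y hy
  simp only [Function.comp] at h3
  have hp : deriv f (α y) = 1 / deriv α y := by
    rw [eq_div_iff ha]; exact k
  rw [hp] at h3 ⊢
  generalize deriv (deriv f) (α y) = F at *
  generalize deriv α y = a at *
  field_simp at h3 ⊢
  linear_combination h3
end

section
/- Let m be a natural number and let f₁, f₂ : ℝ → ℝ be of class C^{2m}, with f₁(0) = f₂(0) = 0, f₁^{(k)}(0) = f₂^{(k)}(0) = 0 for every odd k ≤ 2m, and f₁^{(k)}(0) = (−1)^{k/2}·f₂^{(k)}(0) for every even k ≤ 2m. Define u : ℝ² → ℝ by u(x,y) = f₁(√(x² − y²)) when x² > y², u(x,y) = f₂(√(y² − x²)) when y² > x², and u(x,y) = 0 when x² = y². Then u is of class C^m on ℝ². -/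
open Set Filter

noncomputable def hgH (j : ℕ) (φ : ℝ → ℝ) (s : ℝ) : ℝ := ∫ t in (0:ℝ)..1, t ^ j * φ (s * t)

lemma hgH_continuous (j : ℕ) {φ : ℝ → ℝ} (h : Continuous φ) : Continuous (hgH j φ) := by
  unfold hgH
  apply intervalIntegral.continuous_parametric_intervalIntegral_of_continuous'
  simp only [Function.uncurry_def]
  fun_prop

lemma hgH_hasDerivAt (j : ℕ) {φ : ℝ → ℝ} (h : ContDiff ℝ 1 φ) (s : ℝ) :
    HasDerivAt (hgH j φ) (hgH (j + 1) (deriv φ) s) s := by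
  have hc : Continuous φ := h.continuous
  have hd : Continuous (deriv φ) := h.continuous_deriv le_rfl
  obtain ⟨C, hC⟩ := (isCompact_Icc (a := -(|s| + 1)) (b := |s| + 1)).exists_bound_of_continuousOn
    hd.continuousOn
  refine (intervalIntegral.hasDerivAt_integral_of_dominated_loc_of_deriv_le
    (F := fun s t => t ^ j * φ (s * t)) (F' := fun s t => t ^ (j + 1) * deriv φ (s * t))
    (bound := fun _ => C) (s := Metric.ball s 1) (Metric.ball_mem_nhds s one_pos)
    ?_ ?_ ?_ ?_ ?_ ?_).2
  · refine Eventually.of_forall fun x => Continuous.aestronglyMeasurable (by fun_prop)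
  · exact Continuous.intervalIntegrable (by fun_prop) _ _
  · exact Continuous.aestronglyMeasurable (by fun_prop)
  · refine Eventually.of_forall fun t ht x hx => ?_
    rw [uIoc_of_le zero_le_one] at ht
    have hx' : |x| ≤ |s| + 1 := by
      rw [Metric.mem_ball, Real.dist_eq] at hx
      have := abs_sub_abs_le_abs_sub x s
      linarith
    have hxt : |x * t| ≤ |s| + 1 := by
      rw [abs_mul, abs_of_pos ht.1]
      nlinarith [abs_nonneg x, ht.1, ht.2]
    have h1 := hC (x * t) (abs_le.1 hxt)
    have h2 : t ^ (j + 1) ≤ 1 := pow_le_one₀ ht.1.le ht.2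
    have h3 : 0 ≤ t ^ (j + 1) := pow_nonneg ht.1.le _
    rw [norm_mul, Real.norm_of_nonneg h3]
    nlinarith [norm_nonneg (deriv φ (x * t))]
  · exact continuous_const.intervalIntegrable _ _
  · refine Eventually.of_forall fun t ht x hx => ?_
    have h1 : HasDerivAt φ (deriv φ (x * t)) (x * t) :=
      ((h.differentiable one_ne_zero) _).hasDerivAt
    have h2 : HasDerivAt (fun y : ℝ => y * t) t x := by
      simpa using (hasDerivAt_id x).mul_const t
    have := (h1.comp x h2).const_mul (t ^ j)
    refine this.congr_deriv ?_
    ring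

lemma hgH_contDiff (n : ℕ) : ∀ (j : ℕ) (φ : ℝ → ℝ), ContDiff ℝ n φ → ContDiff ℝ n (hgH j φ) := by
  induction n with
  | zero =>
    intro j φ h
    exact contDiff_zero.2 (hgH_continuous j (contDiff_zero.1 h))
  | succ n ih =>
    intro j φ h
    have h1 : ContDiff ℝ 1 φ := h.of_le (by exact_mod_cast Nat.le_add_left 1 n)
    push_cast at h ⊢
    rw [contDiff_succ_iff_deriv] at h ⊢
    refine ⟨fun s => (hgH_hasDerivAt j h1 s).differentiableAt, by simp, ?_⟩
    have : deriv (hgH j φ) = hgH (j + 1) (deriv φ) :=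
      funext fun s => (hgH_hasDerivAt j h1 s).deriv
    rw [this]
    exact ih _ _ h.2.2

lemma hgH_iter (k : ℕ) : ∀ (j : ℕ) (φ : ℝ → ℝ), ContDiff ℝ k φ →
    iteratedDeriv k (hgH j φ) = hgH (j + k) (iteratedDeriv k φ) := by
  induction k with
  | zero =>
    intro j φ h
    simp
  | succ n ih =>
    intro j φ h
    have h1 : ContDiff ℝ 1 φ := h.of_le (by exact_mod_cast Nat.le_add_left 1 n)
    have : deriv (hgH j φ) = hgH (j + 1) (deriv φ) :=
      funext fun s => (hgH_hasDerivAt j h1 s).deriv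
    push_cast at h
    rw [contDiff_succ_iff_deriv] at h
    rw [iteratedDeriv_succ', this, ih _ _ h.2.2, iteratedDeriv_succ']
    congr 1
    ring

lemma hgH_zero (j : ℕ) (φ : ℝ → ℝ) : hgH j φ 0 = φ 0 / (j + 1) := by
  simp [hgH, integral_pow]
  ring

lemma hgH_iter_zero (k : ℕ) (φ : ℝ → ℝ) (h : ContDiff ℝ k φ) (c : ℝ) :
    iteratedDeriv k (fun s => c * hgH 0 φ s) 0 = c * (iteratedDeriv k φ 0 / (k + 1)) := by
  rw [iteratedDeriv_const_mul_field, hgH_iter k 0 φ h, hgH_zero]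
  simp

lemma hgH_mul {g : ℝ → ℝ} (h : ContDiff ℝ 1 g) (h0 : g 0 = 0) (s : ℝ) :
    s * hgH 0 (deriv g) s = g s := by
  have hd : Continuous (deriv g) := h.continuous_deriv le_rfl
  simp only [hgH, pow_zero, one_mul]
  rw [intervalIntegral.mul_integral_comp_mul_left]
  rw [intervalIntegral.integral_eq_sub_of_hasDerivAt
    (fun x _ => ((h.differentiable one_ne_zero) x).hasDerivAt) (hd.intervalIntegrable _ _)]
  simp [h0]

noncomputable def hgF (f₁ f₂ : ℝ → ℝ) (t : ℝ) : ℝ :=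
  if 0 ≤ t then f₁ (Real.sqrt t) else f₂ (Real.sqrt (-t))

lemma hgF_continuous {f₁ f₂ : ℝ → ℝ} (h₁ : Continuous f₁) (h₂ : Continuous f₂)
    (h : f₁ 0 = f₂ 0) : Continuous (hgF f₁ f₂) := by
  unfold hgF
  refine Continuous.if_le (by fun_prop) (by fun_prop) continuous_const continuous_id ?_
  intro x hx
  have hx' : (0:ℝ) = x := hx
  subst hx'
  simpa using h

lemma hgF_contDiff (m : ℕ) : ∀ (f₁ f₂ : ℝ → ℝ)
    (_ : ContDiff ℝ (2 * m : ℕ) f₁) (_ : ContDiff ℝ (2 * m : ℕ) f₂)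
    (_ : ∀ k : ℕ, k ≤ 2 * m → Odd k →
      iteratedDeriv k f₁ 0 = 0 ∧ iteratedDeriv k f₂ 0 = 0)
    (_ : ∀ k : ℕ, k ≤ 2 * m → Even k →
      iteratedDeriv k f₁ 0 = (-1 : ℝ) ^ (k / 2) * iteratedDeriv k f₂ 0),
    ContDiff ℝ m (hgF f₁ f₂) := by
  induction m with
  | zero =>
    intro f₁ f₂ h₁ h₂ _ he
    have := he 0 (by simp) (by simp)
    simp at this
    exact contDiff_zero.2 (hgF_continuous h₁.continuous h₂.continuous this)
  | succ m ih =>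
    intro f₁ f₂ h₁ h₂ ho he
    have key : ∀ f : ℝ → ℝ, ContDiff ℝ (2 * (m + 1) : ℕ) f →
        ContDiff ℝ 1 f ∧ ContDiff ℝ 1 (deriv f) ∧ ContDiff ℝ (2 * m : ℕ) (deriv (deriv f)) := by
      intro f hf
      have e : ((2 * (m + 1) : ℕ) : WithTop ℕ∞) = ((2 * m : ℕ) : WithTop ℕ∞) + 1 + 1 := by
        norm_cast
      rw [e] at hf
      have a := (contDiff_succ_iff_deriv.1 hf).2.2
      have b := (contDiff_succ_iff_deriv.1 a).2.2
      exact ⟨hf.of_le (by simp), a.of_le (by simp), b⟩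
    obtain ⟨a₁, b₁, c₁⟩ := key f₁ h₁
    obtain ⟨a₂, b₂, c₂⟩ := key f₂ h₂
    have z := ho 1 (by omega) odd_one
    rw [iteratedDeriv_one, iteratedDeriv_one] at z
    have z0 := he 0 (by simp) (by simp)
    simp at z0
    set g₁ : ℝ → ℝ := fun s => (1 / 2) * hgH 0 (deriv (deriv f₁)) s with hg₁
    set g₂ : ℝ → ℝ := fun s => (-1 / 2) * hgH 0 (deriv (deriv f₂)) s with hg₂
    have it₁ : ∀ k ≤ 2 * m, iteratedDeriv k g₁ 0 =
        (1 / 2) * (iteratedDeriv (k + 2) f₁ 0 / (k + 1)) := fun k hk => by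
      rw [hg₁, hgH_iter_zero k _ (c₁.of_le (by exact_mod_cast hk)), iteratedDeriv_succ',
        iteratedDeriv_succ']
    have it₂ : ∀ k ≤ 2 * m, iteratedDeriv k g₂ 0 =
        (-1 / 2) * (iteratedDeriv (k + 2) f₂ 0 / (k + 1)) := fun k hk => by
      rw [hg₂, hgH_iter_zero k _ (c₂.of_le (by exact_mod_cast hk)), iteratedDeriv_succ',
        iteratedDeriv_succ']
    have d₁ : ContDiff ℝ (2 * m : ℕ) g₁ := contDiff_const.mul (hgH_contDiff _ _ _ c₁)
    have d₂ : ContDiff ℝ (2 * m : ℕ) g₂ := contDiff_const.mul (hgH_contDiff _ _ _ c₂)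
    have e : ∀ k : ℕ, k ≤ 2 * m → Even k →
        iteratedDeriv k g₁ 0 = (-1 : ℝ) ^ (k / 2) * iteratedDeriv k g₂ 0 := by
      intro k hk hk2
      rw [it₁ k hk, it₂ k hk, he (k + 2) (by omega) (hk2.add even_two)]
      rw [show (k + 2) / 2 = k / 2 + 1 by omega]
      ring
    have hder : ContDiff ℝ m (hgF g₁ g₂) := by
      refine ih g₁ g₂ d₁ d₂ ?_ e
      intro k hk hk2
      have := ho (k + 2) (by omega) (hk2.add_even even_two)
      rw [it₁ k hk, it₂ k hk, this.1, this.2]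
      simp
    have hcF := hgF_continuous a₁.continuous a₂.continuous z0
    have hD : ∀ t, HasDerivAt (hgF f₁ f₂) (hgF g₁ g₂ t) t := by
      intro t
      refine hasDerivAt_of_hasDerivAt_of_ne' (x := 0) ?_ hcF.continuousAt
        hder.continuous.continuousAt t
      intro t ht
      rcases lt_or_gt_of_ne ht with ht | ht
      · have ev : hgF f₁ f₂ =ᶠ[nhds t] fun t => f₂ (Real.sqrt (-t)) := by
          filter_upwards [Iio_mem_nhds ht] with x hx
          simp [hgF, not_le.2 (mem_Iio.1 hx)]
        refine HasDerivAt.congr_of_eventuallyEq ?_ ev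
        have hs : HasDerivAt (fun t : ℝ => Real.sqrt (-t)) (-1 / (2 * Real.sqrt (-t))) t :=
          (hasDerivAt_neg t).sqrt (by linarith)
        have := (((a₂.differentiable one_ne_zero) (Real.sqrt (-t))).hasDerivAt).comp t hs
        refine HasDerivAt.congr_deriv this ?_
        have hp : 0 < Real.sqrt (-t) := Real.sqrt_pos.2 (by linarith)
        rw [← hgH_mul b₂ z.2 (Real.sqrt (-t))]
        simp only [hgF, not_le.2 ht, if_false, hg₂]
        field_simp
      · have ev : hgF f₁ f₂ =ᶠ[nhds t] fun t => f₁ (Real.sqrt t) := by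
          filter_upwards [Ioi_mem_nhds ht] with x hx
          simp [hgF, le_of_lt (mem_Ioi.1 hx)]
        refine HasDerivAt.congr_of_eventuallyEq ?_ ev
        have hs : HasDerivAt (fun t : ℝ => Real.sqrt t) (1 / (2 * Real.sqrt t)) t :=
          Real.hasDerivAt_sqrt ht.ne'
        have := (((a₁.differentiable one_ne_zero) (Real.sqrt t)).hasDerivAt).comp t hs
        refine HasDerivAt.congr_deriv this ?_
        have hp : 0 < Real.sqrt t := Real.sqrt_pos.2 ht
        rw [← hgH_mul b₁ z.1 (Real.sqrt t)]
        simp only [hgF, le_of_lt ht, if_true, hg₁]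
        field_simp
    push_cast
    rw [contDiff_succ_iff_deriv]
    refine ⟨fun t => (hD t).differentiableAt, by simp, ?_⟩
    rw [show deriv (hgF f₁ f₂) = hgF g₁ g₂ from funext fun t => (hD t).deriv]
    exact hder

/-- **gluing lemma for the Hybrid Translator.** Two `C^{2m}` profiles
whose derivatives at `0` vanish in odd orders and match up to the sign `(-1)^{k/2}` in
even orders glue across the light cone `{x² = y²}` to a `C^m` function on `ℝ²`. -/
theorem hybrid_gluing (m : ℕ) (f₁ f₂ : ℝ → ℝ)
    (hf₁ : ContDiff ℝ (2 * m) f₁) (hf₂ : ContDiff ℝ (2 * m) f₂)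
    (h0₁ : f₁ 0 = 0) (h0₂ : f₂ 0 = 0)
    (hodd : ∀ k : ℕ, k ≤ 2 * m → Odd k →
      iteratedDeriv k f₁ 0 = 0 ∧ iteratedDeriv k f₂ 0 = 0)
    (heven : ∀ k : ℕ, k ≤ 2 * m → Even k →
      iteratedDeriv k f₁ 0 = (-1 : ℝ) ^ (k / 2) * iteratedDeriv k f₂ 0)
    (u : ℝ × ℝ → ℝ)
    (hu : ∀ x y : ℝ, u (x, y) =
      if y ^ 2 < x ^ 2 then f₁ (Real.sqrt (x ^ 2 - y ^ 2))
      else if x ^ 2 < y ^ 2 then f₂ (Real.sqrt (y ^ 2 - x ^ 2))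
      else 0) :
    ContDiff ℝ m u := by
  have hF : ContDiff ℝ m (hgF f₁ f₂) :=
    hgF_contDiff m f₁ f₂ (by exact_mod_cast hf₁) (by exact_mod_cast hf₂) hodd heven
  have hU : u = fun p : ℝ × ℝ => hgF f₁ f₂ (p.1 ^ 2 - p.2 ^ 2) := by
    funext ⟨x, y⟩
    rw [hu]
    simp only [hgF]
    rcases lt_trichotomy (x ^ 2) (y ^ 2) with h | h | h
    · rw [if_neg h.not_gt, if_pos h, if_neg (by linarith), neg_sub]
    · simp [h, h0₁]
    · rw [if_pos h, if_pos (by linarith)]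
  rw [hU]
  exact hF.comp (by fun_prop)
end

section
/- Let R > 0 and let (a_{2k})_{k≥1} be real numbers such that the power series f₁(s) = Σ_{k≥1} a_{2k} s^{2k} converges for |s| < R, and suppose f₁''(s) = (1 + f₁'(s)²)·(1 − f₁'(s)/s) for every s with 0 < |s| < R. Then the series f₂(s) = Σ_{k≥1} (−1)^k a_{2k} s^{2k} also converges for |s| < R, and f₂''(s) = (−1 + f₂'(s)²)·(1 + f₂'(s)/s) for every s with 0 < |s| < R. -/
open Set Filter

theorem aux_deriv (R : ℝ) (G : ℂ → ℂ) (hG : DifferentiableOn ℂ G (Metric.ball 0 R)) (h : ℝ → ℝ)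
    (hh : ∀ s : ℝ, |s| < R → G s = h s) (s : ℝ) (hs : |s| < R) :
    deriv G s = ((deriv h s : ℝ) : ℂ) := by
  have hmem : (s : ℂ) ∈ Metric.ball (0 : ℂ) R := by simpa using hs
  have h1 : HasDerivAt G (deriv G s) (s : ℂ) :=
    (hG.differentiableAt (Metric.isOpen_ball.mem_nhds hmem)).hasDerivAt
  have hev : ∀ᶠ x : ℝ in nhds s, |x| < R :=
    (isOpen_lt continuous_abs continuous_const).mem_nhds hs
  have h2 : HasDerivAt h (deriv G s).re s := by
    refine h1.real_of_complex.congr_of_eventuallyEq ?_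
    filter_upwards [hev] with x hx
    simp [hh x hx]
  have h3 : HasDerivAt (fun x : ℝ => G x) (((deriv G s).re : ℝ) : ℂ) s := by
    refine h2.ofReal_comp.congr_of_eventuallyEq ?_
    filter_upwards [hev] with x hx
    exact hh x hx
  rw [h2.deriv]
  exact h1.comp_ofReal.unique h3

/-- The substitution `s ↦ i·s` at the level of even power series:
if `f₁(s) = Σ_{k≥1} a_{2k} s^{2k}` converges on `(-R, R)` and solves
`f₁'' = (1 + f₁'²)(1 - f₁'/s)` there, then `f₂(s) = Σ_{k≥1} (-1)^k a_{2k} s^{2k}`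
also converges on `(-R, R)` and solves `f₂'' = (-1 + f₂'²)(1 + f₂'/s)`.
Here `a k` denotes the coefficient `a_{2(k+1)}`. -/
theorem power_series_substitution (R : ℝ) (hR : 0 < R) (a : ℕ → ℝ) (f₁ : ℝ → ℝ)
    (hconv₁ : ∀ s : ℝ, |s| < R →
      HasSum (fun k : ℕ => a k * s ^ (2 * k + 2)) (f₁ s))
    (hode₁ : ∀ s : ℝ, 0 < |s| → |s| < R →
      deriv (deriv f₁) s = (1 + (deriv f₁ s) ^ 2) * (1 - deriv f₁ s / s)) :
    ∃ f₂ : ℝ → ℝ,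
      (∀ s : ℝ, |s| < R →
        HasSum (fun k : ℕ => (-1 : ℝ) ^ (k + 1) * a k * s ^ (2 * k + 2)) (f₂ s)) ∧
      (∀ s : ℝ, 0 < |s| → |s| < R →
        deriv (deriv f₂) s = (-1 + (deriv f₂ s) ^ 2) * (1 + deriv f₂ s / s)) := by
  have hsum : ∀ r : ℝ, |r| < R → Summable (fun k : ℕ => |a k| * |r| ^ (2 * k + 2)) := by
    intro r hr
    have := (hconv₁ r hr).summable.abs
    simpa [abs_mul, abs_pow] using this
  set F : ℂ → ℂ := fun z => ∑' k : ℕ, (a k : ℂ) * z ^ (2 * k + 2) with hF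
  have hFs : ∀ z : ℂ, ‖z‖ < R → Summable (fun k : ℕ => (a k : ℂ) * z ^ (2 * k + 2)) := by
    intro z hz
    apply Summable.of_norm
    have := hsum ‖z‖ (by simpa using hz)
    simpa using this
  have hFd : DifferentiableOn ℂ F (Metric.ball 0 R) := by
    intro z hz
    have hz' : ‖z‖ < R := by simpa using hz
    obtain ⟨r, hzr, hrR⟩ := exists_between hz'
    have hr0 : 0 ≤ r := (norm_nonneg z).trans hzr.le
    have hd : DifferentiableOn ℂ F (Metric.ball 0 r) := by
      refine Complex.differentiableOn_tsum_of_summable_norm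
        (hsum r (by rwa [abs_of_nonneg hr0])) (fun k => by fun_prop) Metric.isOpen_ball ?_
      intro k w hw
      have hw' : ‖w‖ < r := by simpa using hw
      rw [norm_mul, norm_pow, abs_of_nonneg hr0, Complex.norm_real, Real.norm_eq_abs]
      gcongr
    exact (hd.differentiableAt
      (Metric.isOpen_ball.mem_nhds (by simpa using hzr))).differentiableWithinAt
  have hFd' : DifferentiableOn ℂ (deriv F) (Metric.ball 0 R) := hFd.deriv Metric.isOpen_ball
  have hFd'' : DifferentiableOn ℂ (deriv (deriv F)) (Metric.ball 0 R) :=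
    hFd'.deriv Metric.isOpen_ball
  have e0 : ∀ s : ℝ, |s| < R → F s = f₁ s := by
    intro s hs
    have h1 : HasSum (fun k : ℕ => ((a k * s ^ (2 * k + 2) : ℝ) : ℂ)) (f₁ s : ℂ) :=
      Complex.hasSum_ofReal.2 (hconv₁ s hs)
    rw [← h1.tsum_eq]
    simp [hF]
  have e1 := aux_deriv R F hFd f₁ e0
  have e2 := aux_deriv R (deriv F) hFd' (deriv f₁) e1
  -- the identity theorem
  have hode : EqOn (fun z => z * deriv (deriv F) z - (1 + deriv F z ^ 2) * (z - deriv F z)) 0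
      (Metric.ball 0 R) := by
    have hA : AnalyticOnNhd ℂ
        (fun z => z * deriv (deriv F) z - (1 + deriv F z ^ 2) * (z - deriv F z))
        (Metric.ball 0 R) := by
      apply DifferentiableOn.analyticOnNhd _ Metric.isOpen_ball
      fun_prop
    refine hA.eqOn_zero_of_preconnected_of_frequently_eq_zero
      (convex_ball (0 : ℂ) R).isPreconnected (Metric.mem_ball_self hR) ?_
    have ht : Tendsto (fun x : ℝ => (x : ℂ)) (nhdsWithin 0 {0}ᶜ) (nhdsWithin 0 {0}ᶜ) := by
      apply tendsto_nhdsWithin_of_tendsto_nhds_of_eventually_within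
      · have : Tendsto (fun x : ℝ => (x : ℂ)) (nhds 0) (nhds ((0 : ℝ) : ℂ)) :=
          Complex.continuous_ofReal.tendsto 0
        rw [Complex.ofReal_zero] at this
        exact this.mono_left nhdsWithin_le_nhds
      · filter_upwards [self_mem_nhdsWithin] with x hx
        simpa using hx
    apply ht.frequently
    apply Eventually.frequently
    have hev : ∀ᶠ x : ℝ in nhds 0, |x| < R :=
      (isOpen_lt continuous_abs continuous_const).mem_nhds (by simpa using hR)
    filter_upwards [self_mem_nhdsWithin, nhdsWithin_le_nhds hev] with x hx hxR
    have hx0 : x ≠ 0 := hx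
    have h := hode₁ x (abs_pos.2 hx0) hxR
    rw [e1 x hxR, e2 x hxR]
    have h' : x * deriv (deriv f₁) x - (1 + deriv f₁ x ^ 2) * (x - deriv f₁ x) = 0 := by
      rw [h]; field_simp; ring
    exact_mod_cast h'
  have hIm : ∀ z ∈ Metric.ball (0 : ℂ) R, Complex.I * z ∈ Metric.ball (0 : ℂ) R := by
    intro z hz
    simpa using hz
  have dcomp : ∀ G : ℂ → ℂ, DifferentiableOn ℂ G (Metric.ball 0 R) →
      ∀ z ∈ Metric.ball (0 : ℂ) R,
      HasDerivAt (fun z => G (Complex.I * z)) (Complex.I * deriv G (Complex.I * z)) z := by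
    intro G hG z hz
    have h1 := (hG.differentiableAt (Metric.isOpen_ball.mem_nhds (hIm z hz))).hasDerivAt
    have h2 : HasDerivAt (fun z : ℂ => Complex.I * z) Complex.I z := by
      simpa using (hasDerivAt_id z).const_mul Complex.I
    have := h1.comp z h2
    rw [mul_comm]
    exact this
  set G : ℂ → ℂ := fun z => F (Complex.I * z) with hG
  have hGd : DifferentiableOn ℂ G (Metric.ball 0 R) := fun z hz =>
    (dcomp F hFd z hz).differentiableAt.differentiableWithinAt
  have hG1 : ∀ z ∈ Metric.ball (0 : ℂ) R, deriv G z = Complex.I * deriv F (Complex.I * z) :=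
    fun z hz => (dcomp F hFd z hz).deriv
  have hG2 : ∀ z ∈ Metric.ball (0 : ℂ) R,
      deriv (deriv G) z = - deriv (deriv F) (Complex.I * z) := by
    intro z hz
    have h1 := (dcomp (deriv F) hFd' z hz).const_mul Complex.I
    have h2 : deriv G =ᶠ[nhds z] fun z => Complex.I * deriv F (Complex.I * z) := by
      filter_upwards [Metric.isOpen_ball.mem_nhds hz] with w hw using hG1 w hw
    rw [h2.deriv_eq, h1.deriv, ← mul_assoc, Complex.I_mul_I, neg_one_mul]
  have hGs : ∀ s : ℝ, |s| < R →
      HasSum (fun k : ℕ => (((-1 : ℝ) ^ (k + 1) * a k * s ^ (2 * k + 2) : ℝ) : ℂ)) (G s) := by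
    intro s hs
    have h := (hFs (Complex.I * s) (by simpa using hs)).hasSum
    convert h using 2 with k
    have : Complex.I ^ (2 * k + 2) = (-1) ^ (k + 1) := by
      rw [show 2 * k + 2 = 2 * (k + 1) by ring, pow_mul, Complex.I_sq]
    rw [mul_pow, this]
    push_cast
    ring
  have hre : ∀ s : ℝ, |s| < R →
      HasSum (fun k : ℕ => (-1 : ℝ) ^ (k + 1) * a k * s ^ (2 * k + 2)) (G s).re := by
    intro s hs
    simpa only [Complex.ofReal_re] using Complex.hasSum_re (hGs s hs)
  refine ⟨fun s => (G s).re, hre, ?_⟩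
  have g0 : ∀ s : ℝ, |s| < R → G s = (((fun s : ℝ => (G s).re) s : ℝ) : ℂ) := by
    intro s hs
    exact (hGs s hs).unique (Complex.hasSum_ofReal.2 (hre s hs))
  have g1 := aux_deriv R G hGd _ g0
  have g2 := aux_deriv R (deriv G) (hGd.deriv Metric.isOpen_ball) _ g1
  intro s hs0 hs
  have hsb : (s : ℂ) ∈ Metric.ball (0 : ℂ) R := by simpa using hs
  have k1 := g1 s hs
  have k2 := g2 s hs
  have key := hode (hIm s hsb)
  rw [hG1 _ hsb] at k1
  rw [hG2 _ hsb] at k2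
  set p := deriv (fun s : ℝ => (G s).re) s
  set q := deriv (deriv (fun s : ℝ => (G s).re)) s
  have hp : deriv F (Complex.I * s) = - Complex.I * p := by
    rw [← k1, ← mul_assoc, neg_mul, Complex.I_mul_I]; ring
  have hq : deriv (deriv F) (Complex.I * s) = - q := by
    rw [← k2]; ring
  simp only [hp, hq, Pi.zero_apply] at key
  have key2 : (s : ℂ) * q - (-1 + p ^ 2) * (s + p) = 0 := by
    have hI := Complex.I_sq
    linear_combination Complex.I * key + (s * q + (s + p) * (1 + p ^ 2 * (Complex.I ^ 2 - 1))) * hI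
  have key3 : s * q - (-1 + p ^ 2) * (s + p) = 0 := by exact_mod_cast key2
  have hs' : s ≠ 0 := abs_pos.1 hs0
  field_simp
  linarith
end

section
/- Let n ≥ 2 be a natural number, y₀ ∈ ℝ, and 0 < s₁ < s₂. Let α₁, α₂ be twice differentiable real-valued functions, with positive values, defined on a neighborhood of y₀ and satisfying αᵢ''(y) = (−1 + αᵢ'(y)²)·((n−1)/αᵢ(y) − αᵢ'(y)) with αᵢ(y₀) = sᵢ and αᵢ'(y₀) = 0 for i = 1, 2. Then there exists δ > 0 such that α₁(y) + s₂ − s₁ < α₂(y) for every y with 0 < |y − y₀| < δ. -/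
open Set Filter

/-- **no tangency principle for spindles.** Two spindle profile curves
through `s₁ < s₂` with horizontal tangent at `y₀`: after translating the lower one up
by `s₂ - s₁`, it lies strictly below the other near `y₀`. -/
theorem spindles_no_tangency (n : ℕ) (hn : 2 ≤ n) (y₀ : ℝ) (s₁ s₂ : ℝ)
    (hs₁ : 0 < s₁) (hs₁s₂ : s₁ < s₂)
    (α₁ α₂ : ℝ → ℝ) (U : Set ℝ) (hU : U ∈ nhds y₀)
    (hdiff₁ : ∀ y ∈ U, DifferentiableAt ℝ α₁ y)
    (hdiff₂ : ∀ y ∈ U, DifferentiableAt ℝ α₂ y)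
    (hpos₁ : ∀ y ∈ U, 0 < α₁ y) (hpos₂ : ∀ y ∈ U, 0 < α₂ y)
    (hode₁ : ∀ y ∈ U, HasDerivAt (deriv α₁)
      ((-1 + (deriv α₁ y) ^ 2) * ((n - 1 : ℝ) / α₁ y - deriv α₁ y)) y)
    (hode₂ : ∀ y ∈ U, HasDerivAt (deriv α₂)
      ((-1 + (deriv α₂ y) ^ 2) * ((n - 1 : ℝ) / α₂ y - deriv α₂ y)) y)
    (hinit₁ : α₁ y₀ = s₁) (hinit₂ : α₂ y₀ = s₂)
    (hcrit₁ : deriv α₁ y₀ = 0) (hcrit₂ : deriv α₂ y₀ = 0) :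
    ∃ δ : ℝ, 0 < δ ∧ ∀ y : ℝ, 0 < |y - y₀| → |y - y₀| < δ →
      α₁ y + s₂ - s₁ < α₂ y := by
  have hy₀ : y₀ ∈ U := mem_of_mem_nhds hU
  have h2 := (hode₂ y₀ hy₀).sub (hode₁ y₀ hy₀)
  rw [hcrit₁, hcrit₂, hinit₁, hinit₂] at h2
  have hn' : (0 : ℝ) < (n : ℝ) - 1 := by
    have : (2 : ℝ) ≤ n := by exact_mod_cast hn
    linarith
  have hlt : ((n : ℝ) - 1) / s₂ < ((n : ℝ) - 1) / s₁ :=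
    div_lt_div_of_pos_left hn' hs₁ hs₁s₂
  have hev := (hasDerivAt_iff_tendsto_slope.1 h2).eventually_const_lt
    (u := 0) (by nlinarith)
  rw [eventually_nhdsWithin_iff] at hev
  obtain ⟨δ, hδ, H⟩ := Metric.eventually_nhds_iff.1 (hev.and hU)
  have hd : ∀ y, |y - y₀| < δ →
      HasDerivAt (fun y => α₂ y - α₁ y) (deriv α₂ y - deriv α₁ y) y := by
    intro y hy
    have hyU : y ∈ U := (H (by rwa [Real.dist_eq])).2
    exact (hdiff₂ y hyU).hasDerivAt.sub (hdiff₁ y hyU).hasDerivAt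
  have hs : ∀ y, |y - y₀| < δ → y ≠ y₀ →
      0 < (deriv α₂ y - deriv α₁ y) / (y - y₀) := by
    intro y hy hne
    have h := (H (y := y) (by rwa [Real.dist_eq])).1 hne
    simpa [slope_def_field, hcrit₁, hcrit₂] using h
  refine ⟨δ, hδ, fun y hy0 hyδ => ?_⟩
  have hne : y - y₀ ≠ 0 := abs_pos.1 hy0
  have hyδ' := abs_lt.1 hyδ
  rcases lt_or_gt_of_ne hne with hlt' | hgt'
  · have hb : ∀ x ∈ Icc y y₀, |x - y₀| < δ := fun x hx =>
      abs_lt.2 ⟨by linarith [hx.1], by linarith [hx.2]⟩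
    obtain ⟨c, hc, hce⟩ := exists_hasDerivAt_eq_slope (fun y => α₂ y - α₁ y)
      (fun y => deriv α₂ y - deriv α₁ y) (a := y) (b := y₀) (by linarith)
      (fun x hx => (hd x (hb x hx)).continuousAt.continuousWithinAt)
      (fun x hx => hd x (hb x (Ioo_subset_Icc_self hx)))
    have hp := hs c (hb c (Ioo_subset_Icc_self hc)) hc.2.ne
    have hneg : deriv α₂ c - deriv α₁ c < 0 := by
      by_contra hcon
      exact absurd hp (not_lt.2 (div_nonpos_of_nonneg_of_nonpos (not_lt.1 hcon)
        (by linarith [hc.2])))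
    rw [hce, div_lt_iff₀ (by linarith), hinit₁, hinit₂] at hneg
    linarith
  · have hb : ∀ x ∈ Icc y₀ y, |x - y₀| < δ := fun x hx =>
      abs_lt.2 ⟨by linarith [hx.1], by linarith [hx.2]⟩
    obtain ⟨c, hc, hce⟩ := exists_hasDerivAt_eq_slope (fun y => α₂ y - α₁ y)
      (fun y => deriv α₂ y - deriv α₁ y) (a := y₀) (b := y) (by linarith)
      (fun x hx => (hd x (hb x hx)).continuousAt.continuousWithinAt)
      (fun x hx => hd x (hb x (Ioo_subset_Icc_self hx)))
    have hp := hs c (hb c (Ioo_subset_Icc_self hc)) hc.1.ne'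
    have hpos : 0 < deriv α₂ c - deriv α₁ c := by
      by_contra hcon
      exact absurd hp (not_lt.2 (div_nonpos_of_nonpos_of_nonneg (not_lt.1 hcon)
        (by linarith [hc.1])))
    rw [hce, lt_div_iff₀ (by linarith), hinit₁, hinit₂] at hpos
    linarith
end

section
/- Let n ≥ 2 be a natural number, let 0 < s₁ < ∞, and let w : (0, s₁) → ℝ be a solution of (★) with w(s) < −1 for every s ∈ (0, s₁) and w(s) → −∞ as s → s₁⁻. Fix s₀ ∈ (0, s₁) and define f(s) = ∫_{s₀}^{s} w(x) dx for s ∈ (s₀, s₁). Then f has a finite limit as s → s₁⁻ (equivalently, w is integrable on (s₀, s₁)). -/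
open Set Filter MeasureTheory intervalIntegral

/-- For a solution of `(★)` on `(0, s₁)` staying below `-1` and blowing
up to `-∞` at `s₁`, the primitive `f(s) = ∫_{s₀}^s w` has a finite limit as `s → s₁⁻`;
equivalently, `w` is integrable on `(s₀, s₁)`. -/
theorem blow_up_branch_has_finite_length (n : ℕ) (hn : 2 ≤ n) (s₁ : ℝ) (hs₁ : 0 < s₁)
    (w : ℝ → ℝ)
    (hode : ∀ s ∈ Set.Ioo 0 s₁,
      HasDerivAt w ((1 - w s ^ 2) * (1 - (n - 1 : ℝ) * w s / s)) s)
    (hbound : ∀ s ∈ Set.Ioo 0 s₁, w s < -1)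
    (hblow : Tendsto w (nhdsWithin s₁ (Set.Iio s₁)) atBot)
    (s₀ : ℝ) (hs₀ : s₀ ∈ Set.Ioo 0 s₁) :
    (∃ L : ℝ, Tendsto (fun s : ℝ => ∫ x in s₀..s, w x)
        (nhdsWithin s₁ (Set.Iio s₁)) (nhds L)) ∧
      IntegrableOn w (Set.Ioo s₀ s₁) := by
  obtain ⟨h0, h1⟩ := hs₀
  have hn' : (1:ℝ) ≤ (n:ℝ) - 1 := by
    have : (2:ℝ) ≤ n := by exact_mod_cast hn
    linarith
  let G : ℝ → ℝ := fun s => (1/2) * Real.log (1 - 2 / (1 - w s))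
  let g' : ℝ → ℝ := fun s => 1 - (n - 1 : ℝ) * w s / s
  have hG : ∀ s ∈ Ioo 0 s₁, HasDerivAt G (g' s) s := by
    intro s hs
    have hw := hbound s hs
    have a1 : (1 - w s) ≠ 0 := by linarith
    have a3 : (1 + w s) ≠ 0 := by linarith
    have a2 : (1 - 2 / (1 - w s)) ≠ 0 := by
      have : 1 - 2 / (1 - w s) = -(1 + w s) / (1 - w s) := by field_simp; ring
      rw [this]
      exact div_ne_zero (neg_ne_zero.mpr a3) a1
    have a4 : (1 - w s - 2) ≠ 0 := by intro h; apply a3; linarith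
    have a5 : s ≠ 0 := hs.1.ne'
    have := ((((hasDerivAt_const s (2:ℝ)).div ((hode s hs).const_sub 1) a1).const_sub 1).log a2).const_mul (1/2)
    refine this.congr_deriv ?_
    simp only [g']
    generalize 1 - (n - 1 : ℝ) * w s / s = K
    have : 1 - 2 / (1 - w s) = -(1 + w s) / (1 - w s) := by field_simp; ring
    simp only [Pi.div_apply]
    rw [this]
    field_simp
    ring
  have hGt : Tendsto G (nhdsWithin s₁ (Iio s₁)) (nhds 0) := by
    have t1 : Tendsto (fun s => 1 - w s) (nhdsWithin s₁ (Iio s₁)) atTop := by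
      have := tendsto_atTop_add_const_left _ 1 (tendsto_neg_atBot_atTop.comp hblow)
      exact this.congr fun x => by simp [sub_eq_add_neg]
    have t2 : Tendsto (fun s => 1 - 2 / (1 - w s)) (nhdsWithin s₁ (Iio s₁)) (nhds 1) := by
      simpa using (t1.const_div_atTop 2).const_sub 1
    have := (t2.log one_ne_zero).const_mul (1/2)
    simpa [G] using this
  let H : ℝ → ℝ := Function.update G s₁ 0
  have hHd : ∀ s ∈ Ioo s₀ s₁, HasDerivAt H (g' s) s := by
    intro s hs
    refine (hG s ⟨h0.trans hs.1, hs.2⟩).congr_of_eventuallyEq ?_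
    filter_upwards [isOpen_ne.mem_nhds hs.2.ne] with x hx
    exact Function.update_of_ne hx _ _
  have hHc : ContinuousOn H (Icc s₀ s₁) := by
    intro s hs
    rcases eq_or_lt_of_le hs.2 with rfl | hlt
    · have : ContinuousWithinAt H (Iic s) s := by
        rw [continuousWithinAt_update_same]
        rwa [Iic_sdiff_right]
      exact this.mono Icc_subset_Iic_self
    · refine (ContinuousAt.congr (hG s ⟨h0.trans_le hs.1, hlt⟩).continuousAt ?_).continuousWithinAt
      filter_upwards [isOpen_ne.mem_nhds hlt.ne] with x hx
      exact (Function.update_of_ne hx _ _).symm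
  have hkey : ∀ s ∈ Ioo s₀ s₁, -w s ≤ s₁ * g' s := by
    intro s hs
    have hs0 : 0 < s := h0.trans hs.1
    have hw := hbound s ⟨hs0, hs.2⟩
    have e : s₁ * g' s = s₁ + (s₁ / s) * (((n:ℝ) - 1) * (-w s)) := by
      simp only [g']; field_simp; ring
    have b1 : 1 ≤ s₁ / s := (one_le_div hs0).2 hs.2.le
    have b2 : -w s ≤ ((n:ℝ) - 1) * (-w s) := by nlinarith
    rw [e]
    nlinarith
  have hgp : ∀ s ∈ Ioo s₀ s₁, 0 ≤ g' s := by
    intro s hs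
    have hw := hbound s ⟨h0.trans hs.1, hs.2⟩
    have := hkey s hs
    by_contra hc
    nlinarith
  have hgi : IntegrableOn g' (Ioc s₀ s₁) :=
    integrableOn_deriv_of_nonneg hHc hHd hgp
  have hwc : ContinuousOn w (Ioo s₀ s₁) := fun s hs =>
    (hode s ⟨h0.trans hs.1, hs.2⟩).continuousAt.continuousWithinAt
  have hwi : IntegrableOn w (Ioo s₀ s₁) := by
    refine Integrable.mono' ((hgi.mono_set Ioo_subset_Ioc_self).const_mul s₁)
      (hwc.aestronglyMeasurable measurableSet_Ioo) ?_
    filter_upwards [ae_restrict_mem measurableSet_Ioo] with s hs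
    have hw := hbound s ⟨h0.trans hs.1, hs.2⟩
    rw [Real.norm_eq_abs, abs_of_neg (by linarith)]
    exact hkey s hs
  refine ⟨⟨∫ x in s₀..s₁, w x, ?_⟩, hwi⟩
  have hI : IntegrableOn w (uIcc s₀ s₁) := by
    rw [uIcc_of_le h1.le]
    exact (integrableOn_Icc_iff_integrableOn_Ioo).2 hwi
  have hc := continuousOn_primitive_interval hI s₁ right_mem_uIcc
  rw [uIcc_of_le h1.le] at hc
  have hc' := hc.tendsto.mono_left (nhdsWithin_mono _ Ioo_subset_Icc_self)
  rwa [nhdsWithin_Ioo_eq_nhdsLT h1] at hc'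
end
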